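/- There exists a constant c > 0 such that for all sufficiently large x, the number of integers n ≤ x such that λ(n) is 2-dense is at least c·x. -/

import Mathlib

open scoped Classical

open Filter

/-- The Carmichael function: the exponent of the unit group `(ℤ/nℤ)ˣ`. -/
noncomputable def carmichael (n : ℕ) : ℕ := Monoid.exponent (ZMod n)ˣ

/-- `n` is `u`-dense. -/
def UDense (n : ℕ) (u : ℝ) : Prop :=
  ∀ y : ℝ, 1 ≤ y → y < (n : ℝ) → ∃ d : ℕ, d ∣ n ∧ y < (d : ℝ) ∧ (d : ℝ) ≤ u * y

theorem UDense.mul_of_le {m q : ℕ} (hm : UDense m 2) (hm0 : 0 < m) (hq0 : 0 < q)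
    (hq : q ≤ 2 * m) : UDense (m * q) 2 := by
  intro y hy1 hy
  have hmR : (0 : ℝ) < m := by exact_mod_cast hm0
  have hqR : (0 : ℝ) < q := by exact_mod_cast hq0
  have hqm : (q : ℝ) ≤ 2 * m := by exact_mod_cast hq
  push_cast at hy
  by_cases h : y < m
  · obtain ⟨d, hd, h1, h2⟩ := hm y hy1 h
    exact ⟨d, hd.mul_right q, h1, h2⟩
  · push Not at h
    by_cases h1 : (q : ℝ) ≤ y
    · obtain ⟨d, hd, h2, h3⟩ := hm (y / q) ((one_le_div hqR).2 h1) ((div_lt_iff₀ hqR).2 hy)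
      refine ⟨d * q, Nat.mul_dvd_mul_right hd q, ?_, ?_⟩
      · push_cast
        exact (div_lt_iff₀ hqR).1 h2
      · push_cast
        calc (d : ℝ) * q ≤ 2 * (y / q) * q := by gcongr
          _ = 2 * y := by field_simp
    · push Not at h1
      exact ⟨q, dvd_mul_left q m, h1, by linarith⟩

theorem UDense.mul_pow_of_le {m q : ℕ} (hm : UDense m 2) (hm0 : 0 < m) (hq0 : 0 < q)
    (hq : q ≤ 2 * m) (v : ℕ) : UDense (m * q ^ v) 2 := by
  induction v with
  | zero => simpa using hm
  | succ v ih =>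
    rw [pow_succ, ← mul_assoc]
    refine ih.mul_of_le (by positivity) hq0 (hq.trans ?_)
    have : 1 ≤ q ^ v := Nat.one_le_pow _ _ hq0
    nlinarith

/-- The part of `n` composed of primes below `B`. -/
def smoothPart (n B : ℕ) : ℕ := ∏ p ∈ Finset.range B with p.Prime, p ^ n.factorization p

theorem smoothPart_pos (n B : ℕ) : 0 < smoothPart n B :=
  Finset.prod_pos fun _ hp => pow_pos (Finset.mem_filter.1 hp).2.pos _

theorem smoothPart_succ_of_prime (n : ℕ) {B : ℕ} (hB : B.Prime) :
    smoothPart n (B + 1) = smoothPart n B * B ^ n.factorization B := by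
  unfold smoothPart
  rw [Finset.range_add_one, Finset.filter_insert, if_pos hB, Finset.prod_insert (by simp), mul_comm]

theorem smoothPart_succ_of_not_prime (n : ℕ) {B : ℕ} (hB : ¬ B.Prime) :
    smoothPart n (B + 1) = smoothPart n B := by
  unfold smoothPart
  rw [Finset.range_add_one, Finset.filter_insert, if_neg hB]

theorem smoothPart_self {n : ℕ} (hn : n ≠ 0) : smoothPart n (n + 1) = n := by
  conv_rhs => rw [← Nat.prod_factorization_pow_eq_self hn]
  rw [Finsupp.prod, smoothPart]
  symm
  refine Finset.prod_subset ?_ ?_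
  · intro p hp
    have := Nat.prime_of_mem_primeFactors hp
    have h2 := Nat.le_of_mem_primeFactors hp
    simp [this]; omega
  · intro p _ hp
    rw [Finsupp.notMem_support_iff.1 hp, pow_zero]

theorem dvd_smoothPart {n d B : ℕ} (hn : n ≠ 0) (hd : d ∣ n)
    (h : ∀ p, p.Prime → p ∣ d → p < B) : d ∣ smoothPart n B := by
  have hd0 : d ≠ 0 := ne_zero_of_dvd_ne_zero hn hd
  rw [← Nat.prod_factorization_pow_eq_self hd0, Finsupp.prod]
  calc _ ∣ ∏ p ∈ d.factorization.support, p ^ n.factorization p := by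
        refine Finset.prod_dvd_prod_of_dvd _ _ fun p _ => pow_dvd_pow _ ?_
        exact (Nat.factorization_le_iff_dvd hd0 hn).2 hd p
    _ ∣ _ := by
        refine Finset.prod_dvd_prod_of_subset _ _ _ fun p hp => ?_
        have := Nat.prime_of_mem_primeFactors hp
        simp [this, h p this (Nat.dvd_of_mem_primeFactors hp)]

theorem uDense_of_forall_prime {n : ℕ} (hn : n ≠ 0)
    (h : ∀ q, q.Prime → q ∣ n → ∃ d, d ∣ n ∧ (∀ p, p.Prime → p ∣ d → p < q) ∧ q ≤ 2 * d) :
    UDense n 2 := by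
  have key : ∀ B, UDense (smoothPart n B) 2 := by
    intro B
    induction B with
    | zero =>
      intro y h1 h2
      simp [smoothPart] at h2
      linarith
    | succ B ih =>
      by_cases hB : B.Prime
      · rw [smoothPart_succ_of_prime n hB]
        by_cases hBn : B ∣ n
        · obtain ⟨d, hd, h1, h2⟩ := h B hB hBn
          have := Nat.le_of_dvd (smoothPart_pos n B) (dvd_smoothPart hn hd h1)
          exact ih.mul_pow_of_le (smoothPart_pos n B) hB.pos (by omega) _
        · rw [Nat.factorization_eq_zero_of_not_dvd hBn]
          simpa using ih
      · rwa [smoothPart_succ_of_not_prime n hB]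
  simpa [smoothPart_self hn] using key (n + 1)

theorem carmichael_ne_zero {n : ℕ} (hn : n ≠ 0) : carmichael n ≠ 0 := by
  have : NeZero n := ⟨hn⟩
  exact Monoid.exponent_ne_zero_of_finite

theorem sub_one_dvd_carmichael {n p : ℕ} (hn : n ≠ 0) (hp : p.Prime) (h : p ∣ n) :
    p - 1 ∣ carmichael n := by
  have : NeZero n := ⟨hn⟩
  have : Fact p.Prime := ⟨hp⟩
  have h1 : Monoid.exponent (ZMod p)ˣ = p - 1 := by
    rw [IsCyclic.exponent_eq_card, Nat.card_eq_fintype_card, ZMod.card_units]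
  rw [← h1]
  exact MonoidHom.exponent_dvd (f := ZMod.unitsMap h) (ZMod.unitsMap_surjective h)

theorem exists_prime_dvd_of_dvd_carmichael {n q : ℕ} (hn : n ≠ 0) (hq : q.Prime)
    (h : q ∣ carmichael n) : ∃ p, p.Prime ∧ p ∣ n ∧ q ≤ p := by
  have : NeZero n := ⟨hn⟩
  have h1 : q ∣ n.totient := by
    rw [← ZMod.card_units_eq_totient, ← Nat.card_eq_fintype_card]
    exact h.trans Group.exponent_dvd_nat_card
  rw [Nat.totient_eq_prod_factorization hn] at h1
  obtain ⟨p, hp, h2⟩ := (hq.prime.dvd_finsuppProd_iff).1 h1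
  have hpp := Nat.prime_of_mem_primeFactors hp
  refine ⟨p, hpp, Nat.dvd_of_mem_primeFactors hp, ?_⟩
  rcases hq.dvd_mul.1 h2 with h3 | h3
  · exact Nat.le_of_dvd hpp.pos (hq.dvd_of_dvd_pow h3)
  · exact (Nat.le_of_dvd (by have := hpp.two_le; omega) h3).trans (Nat.sub_le _ _)

theorem uDense_carmichael {n B v p₀ : ℕ} (hn : n ≠ 0) (hB : ∀ p, p.Prime → p ∣ n → p ≤ B)
    (hp₀ : p₀.Prime) (hp₀n : p₀ ∣ n) (hv : 2 ^ v ∣ p₀ - 1)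
    (h : ∀ q, 2 ^ v < q → q ≤ B → ∃ T : Finset ℕ,
      (∀ r ∈ T, r.Prime ∧ r < q ∧ ∃ p, p.Prime ∧ p ∣ n ∧ r ∣ p - 1) ∧ q ≤ ∏ r ∈ T, r) :
    UDense (carmichael n) 2 := by
  refine uDense_of_forall_prime (carmichael_ne_zero hn) fun q hq hqn => ?_
  by_cases hq2 : q = 2
  · exact ⟨1, one_dvd _, fun p hp hp1 => absurd (Nat.dvd_one.1 hp1) hp.ne_one, by omega⟩
  by_cases hqv : q ≤ 2 ^ v
  · refine ⟨2 ^ v, hv.trans (sub_one_dvd_carmichael hn hp₀ hp₀n), fun p hp hp1 => ?_, by omega⟩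
    have := (Nat.prime_dvd_prime_iff_eq hp Nat.prime_two).1 (hp.dvd_of_dvd_pow hp1)
    have := hq.two_le
    omega
  obtain ⟨p, hp, hpn, hqp⟩ := exists_prime_dvd_of_dvd_carmichael hn hq hqn
  obtain ⟨T, hT, hTq⟩ := h q (by omega) (hqp.trans (hB p hp hpn))
  refine ⟨∏ r ∈ T, r, ?_, ?_, by omega⟩
  · refine Finset.prod_primes_dvd _ (fun r hr => (hT r hr).1.prime) fun r hr => ?_
    obtain ⟨_, _, p, hp, hpn, hrp⟩ := hT r hr
    exact hrp.trans (sub_one_dvd_carmichael hn hp hpn)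
  · intro p hp hpd
    obtain ⟨r, hr, hpr⟩ := (hp.prime.dvd_finsetProd_iff _).1 hpd
    rw [(Nat.prime_dvd_prime_iff_eq hp (hT r hr).1).1 hpr]
    exact (hT r hr).2.1

theorem log_factorial_eq_sum (N : ℕ) :
    Real.log N.factorial = ∑ p ∈ N.primesLE, (N.factorial.factorization p : ℝ) * Real.log p := by
  conv_lhs => rw [← Nat.prod_factorization_pow_eq_self (Nat.factorial_ne_zero N)]
  rw [Finsupp.prod, Nat.cast_prod, Real.log_prod]
  · refine Finset.sum_subset_zero_on_sdiff ?_ ?_ ?_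
    · intro p hp
      have hpp := Nat.prime_of_mem_primeFactors hp
      exact Nat.mem_primesLE.2 ⟨(hpp.dvd_factorial).1 (Nat.dvd_of_mem_primeFactors hp), hpp⟩
    · intro p hp
      rw [Finsupp.notMem_support_iff.1 (Finset.mem_sdiff.1 hp).2]
      simp
    · intro p _
      push_cast
      rw [Real.log_pow]
  · intro p hp
    have hpp := Nat.prime_of_mem_primeFactors hp
    have := hpp.pos
    positivity

theorem sum_log_div_prime_le {N : ℕ} (hN : 1 ≤ N) :
    ∑ p ∈ N.primesLE, Real.log p / p ≤ Real.log N + Real.log 4 := by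
  have hN0 : (0 : ℝ) < N := by exact_mod_cast hN
  have h1 : ∑ p ∈ N.primesLE, ((N : ℝ) / p - 1) * Real.log p ≤ Real.log N.factorial := by
    rw [log_factorial_eq_sum]
    refine Finset.sum_le_sum fun p hp => ?_
    obtain ⟨hpN, hpp⟩ := Nat.mem_primesLE.1 hp
    refine mul_le_mul_of_nonneg_right ?_ (Real.log_natCast_nonneg p)
    have h2 : N / p ≤ N.factorial.factorization p := by
      rw [Nat.factorization_factorial hpp (b := Nat.log p N + 1) (by omega)]
      have hm : 1 ∈ Finset.Ico 1 (Nat.log p N + 1) := by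
        have := Nat.log_pos hpp.one_lt hpN
        exact Finset.mem_Ico.2 ⟨le_rfl, by omega⟩
      simpa using Finset.single_le_sum (f := fun i => N / p ^ i) (fun i _ => Nat.zero_le _) hm
    have h3 : (N : ℝ) / p < (N / p : ℕ) + 1 := by
      rw [← Nat.floor_div_eq_div (K := ℝ)]
      exact Nat.lt_floor_add_one _
    have h4 : ((N / p : ℕ) : ℝ) ≤ N.factorial.factorization p := by exact_mod_cast h2
    linarith
  have h5 : Real.log N.factorial ≤ N * Real.log N := by
    rw [← Real.log_pow]
    exact Real.log_le_log (by positivity) (by exact_mod_cast Nat.factorial_le_pow N)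
  have h6 : ∑ p ∈ N.primesLE, Real.log p ≤ Real.log 4 * N := by
    rw [← Chebyshev.theta_eq_sum_primesLE_log]
    exact Chebyshev.theta_le_log4_mul_x hN0.le
  have h7 : ∑ p ∈ N.primesLE, ((N : ℝ) / p - 1) * Real.log p
      = N * ∑ p ∈ N.primesLE, Real.log p / p - ∑ p ∈ N.primesLE, Real.log p := by
    rw [Finset.mul_sum, ← Finset.sum_sub_distrib]
    refine Finset.sum_congr rfl fun p _ => by ring
  have h8 : (N : ℝ) * ∑ p ∈ N.primesLE, Real.log p / p ≤ N * (Real.log N + Real.log 4) := by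
    rw [h7] at h1; linarith
  exact le_of_mul_le_mul_left h8 hN0

theorem exists_sum_log_div_prime_ge :
    ∃ C : ℝ, ∀ N : ℕ, 1 ≤ N → Real.log N - C ≤ ∑ p ∈ N.primesLE, Real.log p / p := by
  have hs : Summable fun n : ℕ => 1 / (n : ℝ) ^ (3 / 2 : ℝ) :=
    Real.summable_one_div_nat_rpow.2 (by norm_num)
  refine ⟨1 + 4 * ∑' n : ℕ, 1 / (n : ℝ) ^ (3 / 2 : ℝ), fun N hN => ?_⟩
  have hN0 : (0 : ℝ) < N := by exact_mod_cast hN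
  have h1 : Real.log N.factorial ≤ N * ∑ p ∈ N.primesLE, (Real.log p / p
      + 4 * (1 / (p : ℝ) ^ (3 / 2 : ℝ))) := by
    rw [log_factorial_eq_sum, Finset.mul_sum]
    refine Finset.sum_le_sum fun p hp => ?_
    obtain ⟨hpN, hpp⟩ := Nat.mem_primesLE.1 hp
    have hp2 : (2 : ℝ) ≤ p := by exact_mod_cast hpp.two_le
    have hlog := Real.log_natCast_nonneg p
    have : Fact p.Prime := ⟨hpp⟩
    have h2 : (N.factorial.factorization p : ℝ) * (p - 1) ≤ N := by
      have := sub_one_mul_padicValNat_factorial (p := p) N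
      rw [← Nat.factorization_def _ hpp] at this
      have h3 : (p - 1) * N.factorial.factorization p ≤ N := by omega
      have h4 : (((p - 1) * N.factorial.factorization p : ℕ) : ℝ) ≤ N := by exact_mod_cast h3
      rw [Nat.cast_mul, Nat.cast_sub hpp.one_le] at h4
      push_cast at h4
      linarith
    have h3 : (N.factorial.factorization p : ℝ) ≤ N / (p - 1) := by
      rwa [le_div_iff₀ (by linarith)]
    have h4 : Real.log p ≤ 2 * (p : ℝ) ^ (1 / 2 : ℝ) := by
      have := Real.log_le_rpow_div (x := p) (ε := 1 / 2) (by linarith) (by norm_num)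
      linarith
    have hpw : (p : ℝ) ^ (3 / 2 : ℝ) * (p : ℝ) ^ (1 / 2 : ℝ) = p ^ 2 := by
      rw [← Real.rpow_add (by linarith)]
      norm_num
    have hpos : 0 < (p : ℝ) ^ (3 / 2 : ℝ) := by positivity
    have h5 : Real.log p / (p - 1) ≤ Real.log p / p + 4 * (1 / (p : ℝ) ^ (3 / 2 : ℝ)) := by
      have h6 : Real.log p / (p - 1) - Real.log p / p = Real.log p / (p * (p - 1)) := by
        have : (p : ℝ) - 1 ≠ 0 := by linarith
        field_simp
        ring
      have h7 : Real.log p / (p * (p - 1)) ≤ 4 * (1 / (p : ℝ) ^ (3 / 2 : ℝ)) := by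
        rw [mul_one_div, div_le_div_iff₀ (by nlinarith) hpos]
        calc Real.log p * (p : ℝ) ^ (3 / 2 : ℝ)
            ≤ 2 * (p : ℝ) ^ (1 / 2 : ℝ) * (p : ℝ) ^ (3 / 2 : ℝ) := by gcongr
          _ = 2 * p ^ 2 := by rw [← hpw]; ring
          _ ≤ 4 * (p * (p - 1)) := by nlinarith
      linarith
    calc (N.factorial.factorization p : ℝ) * Real.log p ≤ N / (p - 1) * Real.log p := by gcongr
      _ = N * (Real.log p / (p - 1)) := by ring
      _ ≤ _ := by gcongr
  have h2 := Stirling.le_log_factorial_stirling (n := N) (by omega)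
  have h3 : 0 ≤ Real.log N := Real.log_natCast_nonneg N
  have h4 : 0 ≤ Real.log (2 * Real.pi) := Real.log_nonneg (by nlinarith [Real.pi_gt_three])
  have h5 : ∑ p ∈ N.primesLE, 1 / (p : ℝ) ^ (3 / 2 : ℝ) ≤ ∑' n : ℕ, 1 / (n : ℝ) ^ (3 / 2 : ℝ) :=
    hs.sum_le_tsum _ fun n _ => by positivity
  rw [Finset.sum_add_distrib, ← Finset.mul_sum] at h1
  have h6 : (N : ℝ) * (Real.log N - 1) ≤ N * (∑ p ∈ N.primesLE, Real.log p / p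
      + 4 * ∑ p ∈ N.primesLE, 1 / (p : ℝ) ^ (3 / 2 : ℝ)) := by linarith
  have h7 := le_of_mul_le_mul_left h6 hN0
  linarith

/-- Lower bound for the sum of reciprocals of primes on an interval. -/
theorem exists_sum_inv_prime_Ioc_ge : ∃ C : ℝ, 0 < C ∧ ∀ M N : ℕ, 1 ≤ M → M ≤ N → 2 ≤ N →
    (Real.log N - Real.log M - C) / Real.log N
      ≤ ∑ p ∈ (Finset.Ioc M N).filter Nat.Prime, (1 : ℝ) / p := by
  obtain ⟨C, hC⟩ := exists_sum_log_div_prime_ge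
  refine ⟨|C| + Real.log 4, by positivity, fun M N hM hMN hN => ?_⟩
  have hlogN : 0 < Real.log N := Real.log_pos (by exact_mod_cast hN)
  rw [div_le_iff₀ hlogN, Finset.sum_mul]
  have h1 : N.primesLE = M.primesLE ∪ (Finset.Ioc M N).filter Nat.Prime := by
    ext p
    simp only [Nat.mem_primesLE, Finset.mem_union, Finset.mem_filter, Finset.mem_Ioc]
    constructor
    · rintro ⟨h1, h2⟩
      by_cases h : p ≤ M
      · exact Or.inl ⟨h, h2⟩
      · exact Or.inr ⟨⟨by omega, h1⟩, h2⟩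
    · rintro (⟨h1, h2⟩ | ⟨⟨h1, h2⟩, h3⟩)
      · exact ⟨by omega, h2⟩
      · exact ⟨h2, h3⟩
  have hd : Disjoint M.primesLE ((Finset.Ioc M N).filter Nat.Prime) := by
    rw [Finset.disjoint_left]
    intro p hp hp2
    have := (Nat.mem_primesLE.1 hp).1
    have := (Finset.mem_Ioc.1 (Finset.mem_filter.1 hp2).1).1
    omega
  have h2 := hC N (by omega)
  rw [h1, Finset.sum_union hd] at h2
  have h3 := sum_log_div_prime_le hM
  have h4 : ∑ p ∈ (Finset.Ioc M N).filter Nat.Prime, Real.log p / p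
      ≤ ∑ p ∈ (Finset.Ioc M N).filter Nat.Prime, 1 / (p : ℝ) * Real.log N := by
    refine Finset.sum_le_sum fun p hp => ?_
    obtain ⟨hp1, hp2⟩ := Finset.mem_filter.1 hp
    have hp0 : (0 : ℝ) < p := by exact_mod_cast hp2.pos
    have hpN : (p : ℝ) ≤ N := by exact_mod_cast (Finset.mem_Ioc.1 hp1).2
    rw [one_div_mul_eq_div]
    gcongr
  linarith [le_abs_self C]

theorem sum_le_eulerProduct (f : ℕ →* ℝ) (hf0 : ∀ n, 0 ≤ f n) (hf1 : ∀ p, p.Prime → f p < 1)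
    (N : ℕ) (F : Finset ℕ) (hF : ∀ n ∈ F, n ≠ 0 ∧ ∀ p, p.Prime → p ∣ n → p ≤ N) :
    ∑ n ∈ F, f n ≤ ∏ p ∈ N.primesLE, (1 - f p)⁻¹ := by
  have h1 := (EulerProduct.summable_and_hasSum_smoothNumbers_prod_primesBelow_geometric (f := f)
    (fun {p} hp => by rw [Real.norm_of_nonneg (hf0 p)]; exact hf1 p hp) (N + 1)).2
  have h2 : (N + 1).primesBelow = N.primesLE := by
    ext p
    simp [Nat.mem_primesLE, Nat.mem_primesBelow]
  rw [h2] at h1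
  have h3 : ∀ n ∈ F, n ∈ Nat.smoothNumbers (N + 1) := fun n hn => by
    rw [Nat.mem_smoothNumbers']
    exact fun p hp hpn => Nat.lt_succ_of_le ((hF n hn).2 p hp hpn)
  rw [← h1.tsum_eq]
  have h4 : ∑ n ∈ F, f n = ∑ n ∈ F.subtype (· ∈ Nat.smoothNumbers (N + 1)), f n :=
    (Finset.sum_subtype_of_mem (f := fun n => f n) h3).symm
  rw [h4]
  exact h1.summable.sum_le_tsum _ fun n _ => hf0 _

theorem mul_rpow_neg_le {s : ℝ} (hs : 0 < s) {n : ℕ} (hn : 1 ≤ n) :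
    s * ((n : ℝ) + 1) ^ (-(1 + s)) ≤ (n : ℝ) ^ (-s) - ((n : ℝ) + 1) ^ (-s) := by
  have hn0 : (0 : ℝ) < n := by exact_mod_cast hn
  have h1 : (n : ℝ) = (n + 1) * (1 - 1 / (n + 1)) := by field_simp; ring
  have h2 : (0 : ℝ) < 1 - 1 / (n + 1) := by
    rw [sub_pos, div_lt_one (by linarith)]; linarith
  have h3 : 1 + s / (n + 1) ≤ (1 - 1 / ((n : ℝ) + 1)) ^ (-s) := by
    rw [Real.rpow_def_of_pos h2]
    have h4 := Real.log_le_sub_one_of_pos h2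
    have h5 := Real.add_one_le_exp (Real.log (1 - 1 / ((n : ℝ) + 1)) * -s)
    have h6 : s / ((n : ℝ) + 1) = s * (1 / (n + 1)) := by ring
    nlinarith
  have h4 : (n : ℝ) ^ (-s) = ((n : ℝ) + 1) ^ (-s) * (1 - 1 / ((n : ℝ) + 1)) ^ (-s) := by
    rw [← Real.mul_rpow (by linarith) h2.le, ← h1]
  have h5 : ((n : ℝ) + 1) ^ (-(1 + s)) = ((n : ℝ) + 1) ^ (-s) / (n + 1) := by
    rw [show -(1 + s) = -s - 1 by ring, Real.rpow_sub_one (by linarith)]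
  have h6 : 0 < ((n : ℝ) + 1) ^ (-s) := by positivity
  rw [h4, h5]
  have h7 : s * (((n : ℝ) + 1) ^ (-s) / (n + 1)) = ((n : ℝ) + 1) ^ (-s) * (s / (n + 1)) := by ring
  rw [h7]
  nlinarith

theorem sum_range_rpow_neg_le {s : ℝ} (hs : 0 < s) (N : ℕ) :
    ∑ n ∈ Finset.range N, ((n : ℝ) + 1) ^ (-(1 + s)) ≤ 1 + 1 / s := by
  suffices h : ∑ n ∈ Finset.range (N + 1), ((n : ℝ) + 1) ^ (-(1 + s))
      ≤ 1 + 1 / s * (1 - ((N : ℝ) + 1) ^ (-s)) by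
    have h1 : 0 < ((N : ℝ) + 1) ^ (-s) := by positivity
    have h2 : 0 < 1 / s := by positivity
    rw [Finset.sum_range_succ] at h
    have h3 : 0 < ((N : ℝ) + 1) ^ (-(1 + s)) := by positivity
    nlinarith
  induction N with
  | zero => simp
  | succ N ih =>
    rw [Finset.sum_range_succ]
    have := mul_rpow_neg_le hs (n := N + 1) (by omega)
    have h4 : ((N + 1 : ℕ) + 1 : ℝ) ^ (-(1 + s)) ≤
        1 / s * (((N + 1 : ℕ) : ℝ) ^ (-s) - ((N + 1 : ℕ) + 1 : ℝ) ^ (-s)) := by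
      rw [one_div, ← div_eq_inv_mul, le_div_iff₀ hs, mul_comm]
      exact this
    push_cast at *
    linarith

/-- Upper bound of Mertens type for the Euler product. -/
theorem exists_prod_one_sub_inv_le : ∃ C : ℝ, 0 < C ∧ ∀ N : ℕ, 2 ≤ N →
    ∏ p ∈ N.primesLE, (1 - 1 / (p : ℝ))⁻¹ ≤ C * Real.log N := by
  have hl2 : 0 < Real.log 2 := Real.log_pos (by norm_num)
  refine ⟨Real.exp (2 * (1 + Real.log 4 / Real.log 2)) * (1 / Real.log 2 + 1), by positivity,
    fun N hN => ?_⟩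
  have hlogN2 : Real.log 2 ≤ Real.log N := Real.log_le_log (by norm_num) (by exact_mod_cast hN)
  have hlogN : 0 < Real.log N := by linarith
  set s := 1 / Real.log N with hs
  have hs0 : 0 < s := by positivity
  let f : ℕ →* ℝ :=
    { toFun := fun n => (n : ℝ) ^ (-(1 + s))
      map_one' := by simp
      map_mul' := fun a b => by
        push_cast
        exact Real.mul_rpow (by positivity) (by positivity) }
  have hf : ∀ n : ℕ, f n = (n : ℝ) ^ (-(1 + s)) := fun n => rfl
  have hfp : ∀ p : ℕ, p.Prime → f p = 1 / p * (p : ℝ) ^ (-s) := fun p hp => by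
    have : (0 : ℝ) < p := by exact_mod_cast hp.pos
    rw [hf, show -(1 + s) = -s - 1 by ring, Real.rpow_sub_one (by positivity)]
    ring
  have hps : ∀ p : ℕ, p.Prime → (p : ℝ) ^ (-s) ≤ 1 := fun p hp =>
    Real.rpow_le_one_of_one_le_of_nonpos (by exact_mod_cast hp.one_le) (by linarith)
  have hpi : ∀ p : ℕ, p.Prime → 1 / (p : ℝ) ≤ 1 / 2 := fun p hp => by
    have : (2 : ℝ) ≤ p := by exact_mod_cast hp.two_le
    gcongr
  have hf1 : ∀ p : ℕ, p.Prime → f p ≤ 1 / 2 := fun p hp => by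
    rw [hfp p hp]
    have := hps p hp
    have h2 := hpi p hp
    have h3 : 0 ≤ 1 / (p : ℝ) := by positivity
    nlinarith
  have h1 : HasSum (fun m : (N + 1).smoothNumbers => f m) (∏ p ∈ N.primesLE, (1 - f p)⁻¹) := by
    have h1 := (EulerProduct.summable_and_hasSum_smoothNumbers_prod_primesBelow_geometric (f := f)
      (fun {p} hp => by
        rw [Real.norm_of_nonneg (by rw [hf]; positivity)]
        linarith [hf1 p hp]) (N + 1)).2
    have h2 : (N + 1).primesBelow = N.primesLE := by
      ext p
      simp [Nat.mem_primesLE, Nat.mem_primesBelow]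
    rwa [h2] at h1
  have h2 : ∏ p ∈ N.primesLE, (1 - f p)⁻¹ ≤ 1 + Real.log N := by
    have h3 : 1 + Real.log N = 1 + 1 / s := by rw [hs]; simp
    rw [h3, ← h1.tsum_eq]
    refine Real.tsum_le_of_sum_le (fun n => by rw [hf]; positivity) fun u => ?_
    have h4 : ∑ n ∈ u, f n = ∑ n ∈ u.map (Function.Embedding.subtype _), f n := by
      rw [Finset.sum_map]; rfl
    rw [h4]
    set F := u.map (Function.Embedding.subtype _) with hF
    obtain ⟨K, hK⟩ : ∃ K, ∀ n ∈ F, n ≤ K := ⟨F.sup id, fun n hn => Finset.le_sup (f := id) hn⟩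
    have hpos : ∀ n ∈ F, n ≠ 0 := fun n hn => by
      obtain ⟨a, _, rfl⟩ := Finset.mem_map.1 hn
      exact Nat.ne_zero_of_mem_smoothNumbers a.2
    refine le_trans ?_ (sum_range_rpow_neg_le hs0 K)
    have h5 : ∑ n ∈ Finset.range K, ((n : ℝ) + 1) ^ (-(1 + s))
        = ∑ n ∈ (Finset.range K).image (· + 1), f n := by
      rw [Finset.sum_image (by simp)]
      refine Finset.sum_congr rfl fun n _ => by rw [hf]; push_cast; rfl
    rw [h5]
    refine Finset.sum_le_sum_of_subset_of_nonneg (fun n hn => ?_) fun n _ _ => by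
      rw [hf]; positivity
    have := hpos n hn
    have := hK n hn
    simp only [Finset.mem_image, Finset.mem_range]
    exact ⟨n - 1, by omega, by omega⟩
  have h3 : ∀ p ∈ N.primesLE, (1 - 1 / (p : ℝ))⁻¹
      ≤ (1 - f p)⁻¹ * Real.exp (2 * s * (Real.log p / p)) := by
    intro p hp
    have hpp := (Nat.mem_primesLE.1 hp).2
    have hp0 : (0 : ℝ) < p := by exact_mod_cast hpp.pos
    have a1 := hpi p hpp
    have a2 := hf1 p hpp
    have a3 : (p : ℝ) ^ (-s) ≥ 1 - s * Real.log p := by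
      rw [Real.rpow_def_of_pos hp0]
      have := Real.add_one_le_exp (Real.log p * -s)
      linarith
    have a4 := Real.add_one_le_exp (2 * s * (Real.log p / p))
    have a5 : (1 - f p) ≤ (1 - 1 / (p : ℝ)) * Real.exp (2 * s * (Real.log p / p)) := by
      have a6 : 0 ≤ 1 / (p : ℝ) := by positivity
      have a7 : Real.log p / p = 1 / p * Real.log p := by ring
      have a8 : 0 ≤ s * (1 / (p : ℝ) * Real.log p) := by
        have := Real.log_natCast_nonneg p; positivity
      have a9 : 1 - f p ≤ 1 - 1 / p + s * (1 / p * Real.log p) := by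
        rw [hfp p hpp]; nlinarith
      rw [a7] at a4 ⊢
      nlinarith
    rw [inv_eq_one_div, inv_eq_one_div, one_div_mul_eq_div, div_le_div_iff₀ (by linarith) (by linarith)]
    linarith
  calc ∏ p ∈ N.primesLE, (1 - 1 / (p : ℝ))⁻¹
      ≤ ∏ p ∈ N.primesLE, ((1 - f p)⁻¹ * Real.exp (2 * s * (Real.log p / p))) := by
        refine Finset.prod_le_prod (fun p hp => ?_) h3
        have := hpi p (Nat.mem_primesLE.1 hp).2
        rw [inv_nonneg]; linarith
    _ = (∏ p ∈ N.primesLE, (1 - f p)⁻¹) *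
          Real.exp (2 * s * ∑ p ∈ N.primesLE, Real.log p / p) := by
        rw [Finset.prod_mul_distrib, ← Real.exp_sum, Finset.mul_sum]
    _ ≤ (1 + Real.log N) * Real.exp (2 * (1 + Real.log 4 / Real.log 2)) := by
        have b1 := sum_log_div_prime_le (N := N) (by omega)
        have b2 : s * ∑ p ∈ N.primesLE, Real.log p / p ≤ 1 + Real.log 4 / Real.log 2 := by
          calc s * ∑ p ∈ N.primesLE, Real.log p / p ≤ s * (Real.log N + Real.log 4) := by gcongr
            _ = 1 + Real.log 4 / Real.log N := by rw [hs]; field_simp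
            _ ≤ _ := by gcongr
        have b3 : 2 * s * ∑ p ∈ N.primesLE, Real.log p / p
            ≤ 2 * (1 + Real.log 4 / Real.log 2) := by linarith
        gcongr
    _ ≤ _ := by
        have c1 : 1 ≤ 1 / Real.log 2 * Real.log N := by
          rw [one_div_mul_eq_div, le_div_iff₀ hl2]; linarith
        have c2 : 1 + Real.log N ≤ (1 / Real.log 2 + 1) * Real.log N := by linarith
        calc _ ≤ ((1 / Real.log 2 + 1) * Real.log N) *
              Real.exp (2 * (1 + Real.log 4 / Real.log 2)) := by gcongr
          _ = _ := by ring

theorem sum_range_mul_of_coprime {a b : ℕ} (hab : a.Coprime b) (ha : 0 < a) (hb : 0 < b)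
    {f g : ℕ → ℝ} (hf : ∀ n, f (n % a) = f n) (hg : ∀ n, g (n % b) = g n) :
    ∑ n ∈ Finset.range (a * b), f n * g n
      = (∑ i ∈ Finset.range a, f i) * ∑ j ∈ Finset.range b, g j := by
  rw [Finset.sum_mul_sum, ← Finset.sum_product']
  refine Finset.sum_nbij (fun n => (n % a, n % b)) ?_ ?_ ?_ ?_
  · intro n _
    simp [Nat.mod_lt _ ha, Nat.mod_lt _ hb]
  · intro m hm n hn hmn
    simp only [Prod.mk.injEq] at hmn
    have h : m ≡ n [MOD a * b] := (Nat.modEq_and_modEq_iff_modEq_mul hab).1 hmn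
    exact Nat.ModEq.eq_of_lt_of_lt h (by simpa using hm) (by simpa using hn)
  · rintro ⟨i, j⟩ hij
    simp only [Finset.coe_product, Finset.coe_range, Set.mem_prod, Set.mem_Iio] at hij
    refine ⟨Nat.chineseRemainder hab i j, ?_, ?_⟩
    · simpa using Nat.chineseRemainder_lt_mul hab i j ha.ne' hb.ne'
    · have h := (Nat.chineseRemainder hab i j).2
      have h1 := h.1
      have h2 := h.2
      simp only [Nat.ModEq, Nat.mod_eq_of_lt hij.1, Nat.mod_eq_of_lt hij.2] at h1 h2
      simp [h1, h2]
  · intro n _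
    simp [hf, hg]

theorem sum_range_prod_eq_prod_sum {s : Finset ℕ} (hs : ∀ r ∈ s, r.Prime) {g : ℕ → ℕ → ℝ}
    (hg : ∀ r ∈ s, ∀ n, g r (n % r) = g r n) :
    ∑ n ∈ Finset.range (∏ r ∈ s, r), ∏ r ∈ s, g r n
      = ∏ r ∈ s, ∑ a ∈ Finset.range r, g r a := by
  induction s using Finset.induction_on with
  | empty => simp
  | insert q s hq ih =>
    have hs' : ∀ r ∈ s, r.Prime := fun r hr => hs r (Finset.mem_insert_of_mem hr)
    have hqp : q.Prime := hs q (Finset.mem_insert_self q s)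
    simp only [Finset.prod_insert hq]
    rw [sum_range_mul_of_coprime (f := fun n => g q n) (g := fun n => ∏ r ∈ s, g r n), ih hs']
    · exact fun r hr => hg r (Finset.mem_insert_of_mem hr)
    · refine Nat.Coprime.prod_right fun r hr => (Nat.coprime_primes hqp (hs' r hr)).2 ?_
      rintro rfl
      exact hq hr
    · exact hqp.pos
    · exact Finset.prod_pos fun r hr => (hs' r hr).pos
    · exact hg q (Finset.mem_insert_self q s)
    · intro n
      refine Finset.prod_congr rfl fun r hr => ?_
      rw [← hg r (Finset.mem_insert_of_mem hr), Nat.mod_mod_of_dvd _ (Finset.dvd_prod_of_mem _ hr),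
        hg r (Finset.mem_insert_of_mem hr)]

theorem sum_range_add_of_periodic {P : ℕ} {f : ℕ → ℝ} (hf : ∀ n, f (n + P) = f n) (a : ℕ) :
    ∑ i ∈ Finset.range P, f (a + i) = ∑ i ∈ Finset.range P, f i := by
  induction a with
  | zero => simp
  | succ a ih =>
    rw [← ih]
    have h1 := Finset.sum_range_succ (fun i => f (a + i)) P
    have h2 := Finset.sum_range_succ' (fun i => f (a + i)) P
    rw [h1] at h2
    rw [hf a] at h2
    simp only [add_zero] at h2
    have h3 : ∀ i, f (a + 1 + i) = f (a + (i + 1)) := fun i => by congr 1; ring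
    simp only [h3]
    linarith

theorem abs_sum_range_le_of_periodic {P : ℕ} (hP : 0 < P) {f : ℕ → ℝ} {B : ℝ}
    (hf : ∀ n, f (n + P) = f n) (h0 : ∑ i ∈ Finset.range P, f i = 0) (hB : ∀ n, |f n| ≤ B)
    (a L : ℕ) : |∑ i ∈ Finset.range L, f (a + i)| ≤ P * B := by
  have hB0 : 0 ≤ B := (abs_nonneg _).trans (hB 0)
  induction L using Nat.strong_induction_on generalizing a with
  | _ L ih =>
    by_cases h : L < P
    · calc |∑ i ∈ Finset.range L, f (a + i)| ≤ ∑ i ∈ Finset.range L, |f (a + i)| :=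
          Finset.abs_sum_le_sum_abs _ _
        _ ≤ ∑ i ∈ Finset.range L, B := Finset.sum_le_sum fun i _ => hB _
        _ = L * B := by simp
        _ ≤ P * B := by gcongr
    · obtain ⟨K, rfl⟩ := Nat.exists_eq_add_of_le (not_lt.1 h)
      rw [Finset.sum_range_add, sum_range_add_of_periodic hf, h0, zero_add]
      simp only [← add_assoc]
      exact ih K (by omega) (a + P)

theorem abs_sum_range_mul_le {c g : ℕ → ℝ} {K : ℝ} (hc : Antitone c) (hc0 : ∀ i, 0 ≤ c i)
    (hg : ∀ L, |∑ i ∈ Finset.range L, g i| ≤ K) (L : ℕ) :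
    |∑ i ∈ Finset.range L, c i * g i| ≤ K * c 0 := by
  have hK : 0 ≤ K := (abs_nonneg _).trans (hg 0)
  have h := Finset.sum_range_by_parts c g L
  simp only [smul_eq_mul] at h
  rw [h]
  have h1 : ∀ n : ℕ, ∑ i ∈ Finset.range n, (c i - c (i + 1)) = c 0 - c n := fun n =>
    Finset.sum_range_sub' c n
  calc |c (L - 1) * ∑ i ∈ Finset.range L, g i
        - ∑ i ∈ Finset.range (L - 1), (c (i + 1) - c i) * ∑ i ∈ Finset.range (i + 1), g i|
      ≤ |c (L - 1) * ∑ i ∈ Finset.range L, g i|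
        + |∑ i ∈ Finset.range (L - 1), (c (i + 1) - c i) * ∑ i ∈ Finset.range (i + 1), g i| :=
        abs_sub _ _
    _ ≤ c (L - 1) * K + ∑ i ∈ Finset.range (L - 1), (c i - c (i + 1)) * K := by
        gcongr
        · rw [abs_mul, abs_of_nonneg (hc0 _)]
          exact mul_le_mul_of_nonneg_left (hg _) (hc0 _)
        · refine (Finset.abs_sum_le_sum_abs _ _).trans (Finset.sum_le_sum fun i _ => ?_)
          rw [abs_mul, abs_sub_comm, abs_of_nonneg (sub_nonneg.2 (hc (Nat.le_succ i)))]
          exact mul_le_mul_of_nonneg_left (hg _) (sub_nonneg.2 (hc (Nat.le_succ i)))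
    _ = K * c 0 := by rw [← Finset.sum_mul, h1]; ring

/-- A bounded periodic function has the expected logarithmic average. -/
theorem abs_log_average_sub_le {P : ℕ} (hP : 0 < P) {f : ℕ → ℝ} {μ : ℝ}
    (hf : ∀ n, f (n + P) = f n) (h0 : ∑ i ∈ Finset.range P, f i = P * μ) (hB : ∀ n, |f n| ≤ 1)
    (N L : ℕ) : |∑ i ∈ Finset.range L, 1 / ((N + 1 + i : ℕ) : ℝ) * f (N + 1 + i)
      - μ * ∑ i ∈ Finset.range L, 1 / ((N + 1 + i : ℕ) : ℝ)| ≤ 2 * P / (N + 1) := by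
  have hP' : (0 : ℝ) < P := by exact_mod_cast hP
  have hμ : |μ| ≤ 1 := by
    have h1 : |(P : ℝ) * μ| ≤ P := by
      rw [← h0]
      refine (Finset.abs_sum_le_sum_abs _ _).trans ?_
      calc _ ≤ ∑ i ∈ Finset.range P, (1 : ℝ) := Finset.sum_le_sum fun i _ => hB i
        _ = P := by simp
    rw [abs_mul, abs_of_pos hP'] at h1
    exact le_of_mul_le_mul_left (by linarith) hP'
  have h1 := abs_sum_range_mul_le (c := fun i => 1 / ((N + 1 + i : ℕ) : ℝ))
    (g := fun i => f (N + 1 + i) - μ) (K := P * 2) ?_ (fun i => by positivity) ?_ L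
  · rw [Finset.mul_sum, ← Finset.sum_sub_distrib]
    calc _ = |∑ i ∈ Finset.range L, 1 / ((N + 1 + i : ℕ) : ℝ) * (f (N + 1 + i) - μ)| := by
          congr 1
          refine Finset.sum_congr rfl fun i _ => by ring
      _ ≤ _ := h1
      _ = _ := by push_cast; ring
  · intro i j hij
    simp only
    gcongr
  · intro L
    refine abs_sum_range_le_of_periodic (f := fun n => f n - μ) hP (fun n => by simp [hf]) ?_ ?_ _ L
    · rw [Finset.sum_sub_distrib, h0]; simp
    · intro n
      have := abs_sub (f n) μ
      linarith [hB n]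

/-- The number of residue classes modulo `r` removed by the sieve. -/
def sieveRho (Q : Finset ℕ) (r : ℕ) : ℝ := if r ∈ Q then 2 else 1

/-- The density ratio of removed to remaining residue classes modulo `r`. -/
noncomputable def sieveH (Q : Finset ℕ) (r : ℕ) : ℝ := sieveRho Q r / (r - sieveRho Q r)

/-- The residue classes removed by the sieve. -/
def SieveBad (Q : Finset ℕ) (r n : ℕ) : Prop := n % r = 0 ∨ r ∈ Q ∧ n % r = 1

/-- The local mean-zero functions attached to the sieve. -/
noncomputable def sievePhi (Q : Finset ℕ) (r n : ℕ) : ℝ :=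
  if SieveBad Q r n then -1 else sieveH Q r

theorem sievePhi_mod (Q : Finset ℕ) (r n : ℕ) : sievePhi Q r (n % r) = sievePhi Q r n := by
  have h : SieveBad Q r (n % r) = SieveBad Q r n := by simp [SieveBad]
  simp only [sievePhi, h]

theorem card_sieveBad {Q : Finset ℕ} {r : ℕ} (hr : 2 ≤ r) :
    (((Finset.range r).filter (SieveBad Q r)).card : ℝ) = sieveRho Q r := by
  by_cases hQ : r ∈ Q
  · have : (Finset.range r).filter (SieveBad Q r) = {0, 1} := by
      ext n
      simp only [Finset.mem_filter, Finset.mem_range, SieveBad, hQ, true_and, Finset.mem_insert,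
        Finset.mem_singleton]
      constructor
      · rintro ⟨h1, h2⟩
        rwa [Nat.mod_eq_of_lt h1] at h2
      · rintro (rfl | rfl)
        · simp; omega
        · rw [Nat.mod_eq_of_lt (by omega)]; simp; omega
    rw [this]
    simp [sieveRho, hQ]
  · have : (Finset.range r).filter (SieveBad Q r) = {0} := by
      ext n
      simp only [Finset.mem_filter, Finset.mem_range, SieveBad, hQ, false_and, or_false,
        Finset.mem_singleton]
      constructor
      · rintro ⟨h1, h2⟩
        rwa [Nat.mod_eq_of_lt h1] at h2
      · rintro rfl
        simp; omega
    rw [this]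
    simp [sieveRho, hQ]

theorem sum_range_ite_sieveBad {Q : Finset ℕ} {r : ℕ} (hr : 2 ≤ r) (a b : ℝ) :
    ∑ n ∈ Finset.range r, (if SieveBad Q r n then a else b)
      = sieveRho Q r * a + (r - sieveRho Q r) * b := by
  rw [Finset.sum_ite, Finset.sum_const, Finset.sum_const, nsmul_eq_mul, nsmul_eq_mul,
    card_sieveBad hr]
  congr 2
  have := Finset.card_filter_add_card_filter_not (s := Finset.range r) (SieveBad Q r)
  rw [Finset.card_range] at this
  have h2 : (((Finset.range r).filter (SieveBad Q r)).card : ℝ)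
    + ((Finset.range r).filter (fun n => ¬ SieveBad Q r n)).card = r := by exact_mod_cast this
  rw [card_sieveBad hr] at h2
  linarith

theorem sieveRho_lt {Q : Finset ℕ} (hQ : ∀ r ∈ Q, 5 ≤ r) {r : ℕ} (hr : r.Prime) :
    sieveRho Q r < r := by
  have := hr.one_lt
  unfold sieveRho
  split_ifs with h
  · exact_mod_cast lt_of_lt_of_le (by norm_num) (hQ r h)
  · exact_mod_cast this

theorem sieveRho_pos (Q : Finset ℕ) (r : ℕ) : 0 < sieveRho Q r := by
  unfold sieveRho; split_ifs <;> norm_num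

theorem sieveH_pos {Q : Finset ℕ} (hQ : ∀ r ∈ Q, 5 ≤ r) {r : ℕ} (hr : r.Prime) :
    0 < sieveH Q r :=
  div_pos (sieveRho_pos Q r) (sub_pos.2 (sieveRho_lt hQ hr))

theorem sieveH_le_one {Q : Finset ℕ} (hQ : ∀ r ∈ Q, 5 ≤ r) {r : ℕ} (hr : r.Prime) :
    sieveH Q r ≤ 1 := by
  rw [sieveH, div_le_one (sub_pos.2 (sieveRho_lt hQ hr))]
  have : (2 : ℝ) ≤ r := by exact_mod_cast hr.two_le
  unfold sieveRho
  split_ifs with h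
  · have : (5 : ℝ) ≤ r := by exact_mod_cast hQ r h
    linarith
  · linarith

theorem sum_range_sievePhi {Q : Finset ℕ} (hQ : ∀ r ∈ Q, 5 ≤ r) {r : ℕ} (hr : r.Prime) :
    ∑ n ∈ Finset.range r, sievePhi Q r n = 0 := by
  have h1 := sub_pos.2 (sieveRho_lt hQ hr)
  unfold sievePhi
  rw [sum_range_ite_sieveBad hr.two_le, sieveH]
  field_simp
  ring

theorem sum_range_sievePhi_sq {Q : Finset ℕ} (hQ : ∀ r ∈ Q, 5 ≤ r) {r : ℕ} (hr : r.Prime) :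
    ∑ n ∈ Finset.range r, sievePhi Q r n * sievePhi Q r n = r * sieveH Q r := by
  have h1 := sub_pos.2 (sieveRho_lt hQ hr)
  have h2 : ∀ n, sievePhi Q r n * sievePhi Q r n
      = if SieveBad Q r n then 1 else sieveH Q r * sieveH Q r := fun n => by
    unfold sievePhi; split_ifs <;> ring
  simp only [h2]
  rw [sum_range_ite_sieveBad hr.two_le, sieveH]
  field_simp
  ring

theorem abs_sievePhi_le {Q : Finset ℕ} (hQ : ∀ r ∈ Q, 5 ≤ r) {r : ℕ} (hr : r.Prime) (n : ℕ) :
    |sievePhi Q r n| ≤ 1 := by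
  unfold sievePhi
  split_ifs
  · simp
  · rw [abs_of_pos (sieveH_pos hQ hr)]
    exact sieveH_le_one hQ hr

theorem abs_sum_sievePhi_mul_sub_le {Q : Finset ℕ} (hQ : ∀ r ∈ Q, 5 ≤ r) {d d' : Finset ℕ}
    (hd : ∀ r ∈ d, r.Prime) (hd' : ∀ r ∈ d', r.Prime) (N L : ℕ) :
    |∑ i ∈ Finset.range L, 1 / ((N + 1 + i : ℕ) : ℝ) *
        ((∏ r ∈ d, sievePhi Q r (N + 1 + i)) * ∏ r ∈ d', sievePhi Q r (N + 1 + i))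
      - (if d = d' then ∏ r ∈ d, sieveH Q r else 0) *
        ∑ i ∈ Finset.range L, 1 / ((N + 1 + i : ℕ) : ℝ)|
      ≤ 2 * ((∏ r ∈ d, (r : ℝ)) * ∏ r ∈ d', (r : ℝ)) / (N + 1) := by
  let g : ℕ → ℕ → ℝ := fun r n =>
    (if r ∈ d then sievePhi Q r n else 1) * (if r ∈ d' then sievePhi Q r n else 1)
  have hu : ∀ r ∈ d ∪ d', r.Prime := fun r hr => by
    rcases Finset.mem_union.1 hr with h | h
    exacts [hd r h, hd' r h]
  have hprod : ∀ n, ∏ r ∈ d ∪ d', g r n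
      = (∏ r ∈ d, sievePhi Q r n) * ∏ r ∈ d', sievePhi Q r n := fun n => by
    simp only [g]
    rw [Finset.prod_mul_distrib, Finset.prod_ite_mem, Finset.prod_ite_mem]
    congr 2
    · exact Finset.inter_eq_right.2 Finset.subset_union_left
    · exact Finset.inter_eq_right.2 Finset.subset_union_right
  have hgmod : ∀ r n, g r (n % r) = g r n := fun r n => by simp only [g, sievePhi_mod]
  have hP : 0 < ∏ r ∈ d ∪ d', r := Finset.prod_pos fun r hr => (hu r hr).pos
  have key := abs_log_average_sub_le (P := ∏ r ∈ d ∪ d', r) hP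
    (f := fun n => ∏ r ∈ d ∪ d', g r n)
    (μ := if d = d' then ∏ r ∈ d, sieveH Q r else 0) ?_ ?_ ?_ N L
  · simp only [hprod] at key
    refine key.trans ?_
    have h1 : ∏ r ∈ d ∪ d', r ≤ (∏ r ∈ d, r) * ∏ r ∈ d', r := by
      rw [← Finset.prod_union_inter]
      exact Nat.le_mul_of_pos_right _
        (Finset.prod_pos fun r hr => (hd r (Finset.mem_inter.1 hr).1).pos)
    have h2 : ((∏ r ∈ d ∪ d', r : ℕ) : ℝ) ≤ (∏ r ∈ d, (r : ℝ)) * ∏ r ∈ d', (r : ℝ) := by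
      have h3 := (Nat.cast_le (α := ℝ)).2 h1
      rwa [Nat.cast_mul, Nat.cast_prod (s := d), Nat.cast_prod (s := d')] at h3
    gcongr
  · intro n
    refine Finset.prod_congr rfl fun r hr => ?_
    rw [← hgmod, ← hgmod r n]
    congr 1
    obtain ⟨k, hk⟩ := Finset.dvd_prod_of_mem (fun r => r) hr
    rw [hk]
    simp
  · rw [sum_range_prod_eq_prod_sum hu fun r _ => hgmod r]
    split_ifs with h
    · subst h
      rw [Finset.union_self]
      push_cast
      rw [← Finset.prod_mul_distrib]
      refine Finset.prod_congr rfl fun r hr => ?_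
      simp only [g, hr, if_true]
      exact sum_range_sievePhi_sq hQ (hd r hr)
    · rw [mul_zero]
      obtain ⟨r, hr⟩ : ∃ r, ¬ (r ∈ d ↔ r ∈ d') := by
        by_contra hc
        push Not at hc
        exact h (Finset.ext hc)
      have hru : r ∈ d ∪ d' := by
        rw [Finset.mem_union]; tauto
      refine Finset.prod_eq_zero hru ?_
      have h0 := sum_range_sievePhi hQ (hu r hru)
      by_cases h1 : r ∈ d
      · have h2 : r ∉ d' := by tauto
        simpa [g, h1, h2] using h0
      · have h2 : r ∈ d' := by tauto
        simpa [g, h1, h2] using h0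
  · intro n
    rw [Finset.abs_prod]
    refine Finset.prod_le_one (fun _ _ => abs_nonneg _) fun r hr => ?_
    have h1 := abs_sievePhi_le hQ (hu r hr) n
    simp only [g]
    rw [abs_mul]
    refine mul_le_one₀ ?_ (abs_nonneg _) ?_
    · split_ifs
      exacts [h1, by simp]
    · split_ifs
      exacts [h1, by simp]

/-- A two-dimensional upper bound sieve with logarithmic weights. -/
theorem sieve_upper_bound {Q : Finset ℕ} (hQ : ∀ r ∈ Q, 5 ≤ r) {R N L : ℕ}
    {D : Finset (Finset ℕ)} (hD : ∀ d ∈ D, (∀ r ∈ d, r.Prime) ∧ ∏ r ∈ d, r ≤ R)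
    {A : Finset ℕ} (hAL : A ⊆ Finset.range L)
    (hA : ∀ i ∈ A, ∀ r, r.Prime → r ≤ R → ¬ SieveBad Q r (N + 1 + i)) :
    (∑ i ∈ A, 1 / ((N + 1 + i : ℕ) : ℝ)) * (∑ d ∈ D, ∏ r ∈ d, sieveH Q r) ^ 2
      ≤ (∑ d ∈ D, ∏ r ∈ d, sieveH Q r) * (∑ i ∈ Finset.range L, 1 / ((N + 1 + i : ℕ) : ℝ))
        + 2 * (R : ℝ) ^ 4 / (N + 1) := by
  set G := ∑ d ∈ D, ∏ r ∈ d, sieveH Q r with hG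
  set V := ∑ i ∈ Finset.range L, 1 / ((N + 1 + i : ℕ) : ℝ) with hV
  let T : ℕ → ℝ := fun n => ∑ d ∈ D, ∏ r ∈ d, sievePhi Q r n
  have hT : ∀ i ∈ A, T (N + 1 + i) = G := by
    intro i hi
    refine Finset.sum_congr rfl fun d hd => Finset.prod_congr rfl fun r hr => ?_
    have hrp := (hD d hd).1 r hr
    have hrR : r ≤ R := le_trans (Nat.le_of_dvd
      (Finset.prod_pos fun r hr => ((hD d hd).1 r hr).pos) (Finset.dvd_prod_of_mem _ hr)) (hD d hd).2
    rw [sievePhi, if_neg (hA i hi r hrp hrR)]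
  have h1 : (∑ i ∈ A, 1 / ((N + 1 + i : ℕ) : ℝ)) * G ^ 2
      ≤ ∑ i ∈ Finset.range L, 1 / ((N + 1 + i : ℕ) : ℝ) * T (N + 1 + i) ^ 2 := by
    rw [Finset.sum_mul]
    calc _ = ∑ i ∈ A, 1 / ((N + 1 + i : ℕ) : ℝ) * T (N + 1 + i) ^ 2 :=
          Finset.sum_congr rfl fun i hi => by rw [hT i hi]
      _ ≤ _ := Finset.sum_le_sum_of_subset_of_nonneg hAL fun i _ _ => by positivity
  have h2 : ∑ i ∈ Finset.range L, 1 / ((N + 1 + i : ℕ) : ℝ) * T (N + 1 + i) ^ 2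
      = ∑ d ∈ D, ∑ d' ∈ D, ∑ i ∈ Finset.range L, 1 / ((N + 1 + i : ℕ) : ℝ) *
        ((∏ r ∈ d, sievePhi Q r (N + 1 + i)) * ∏ r ∈ d', sievePhi Q r (N + 1 + i)) := by
    have hsq : ∀ n, T n ^ 2 = ∑ d ∈ D, ∑ d' ∈ D,
        (∏ r ∈ d, sievePhi Q r n) * ∏ r ∈ d', sievePhi Q r n := fun n => by
      simp only [T]
      rw [sq, Finset.sum_mul_sum]
    rw [Finset.sum_congr rfl fun i _ => by rw [hsq, Finset.mul_sum], Finset.sum_comm]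
    refine Finset.sum_congr rfl fun d _ => ?_
    rw [Finset.sum_congr rfl fun i _ => Finset.mul_sum _ _ _, Finset.sum_comm]
  have h3 : ∑ d ∈ D, ∑ d' ∈ D, ∑ i ∈ Finset.range L, 1 / ((N + 1 + i : ℕ) : ℝ) *
        ((∏ r ∈ d, sievePhi Q r (N + 1 + i)) * ∏ r ∈ d', sievePhi Q r (N + 1 + i))
      ≤ ∑ d ∈ D, ∑ d' ∈ D, ((if d = d' then ∏ r ∈ d, sieveH Q r else 0) * V
        + 2 * ((∏ r ∈ d, (r : ℝ)) * ∏ r ∈ d', (r : ℝ)) / (N + 1)) := by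
    refine Finset.sum_le_sum fun d hd => Finset.sum_le_sum fun d' hd' => ?_
    have := abs_sum_sievePhi_mul_sub_le hQ (hD d hd).1 (hD d' hd').1 N L
    linarith [(abs_le.1 this).2]
  have hcard : (D.card : ℝ) ≤ R := by
    have : D.card ≤ (Finset.Icc 1 R).card := by
      refine Finset.card_le_card_of_injOn (fun d => ∏ r ∈ d, r) ?_ ?_
      · intro d hd
        refine Finset.mem_coe.2 (Finset.mem_Icc.2 ⟨?_, (hD d hd).2⟩)
        exact Finset.prod_pos fun r hr => ((hD d hd).1 r hr).pos
      · intro d hd d' hd' h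
        simp only at h
        rw [← Nat.primeFactors_prod (hD d hd).1, h, Nat.primeFactors_prod (hD d' hd').1]
    rw [Nat.card_Icc] at this
    exact_mod_cast this
  have h4 : ∑ d ∈ D, ∏ r ∈ d, (r : ℝ) ≤ (R : ℝ) ^ 2 := by
    calc ∑ d ∈ D, ∏ r ∈ d, (r : ℝ) ≤ ∑ d ∈ D, (R : ℝ) :=
          Finset.sum_le_sum fun d hd => by
            rw [← Nat.cast_prod]
            exact Nat.cast_le.2 (hD d hd).2
      _ = D.card * R := by simp
      _ ≤ R * R := by gcongr
      _ = (R : ℝ) ^ 2 := by ring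
  have h5 : ∑ d ∈ D, ∑ d' ∈ D, ((if d = d' then ∏ r ∈ d, sieveH Q r else 0) * V
        + 2 * ((∏ r ∈ d, (r : ℝ)) * ∏ r ∈ d', (r : ℝ)) / (N + 1))
      = G * V + 2 * ((∑ d ∈ D, ∏ r ∈ d, (r : ℝ)) * ∑ d ∈ D, ∏ r ∈ d, (r : ℝ)) / (N + 1) := by
    simp only [Finset.sum_add_distrib, ← Finset.sum_mul, ← Finset.sum_div, ← Finset.mul_sum,
      Finset.sum_ite_eq]
    congr 2
    refine Finset.sum_congr rfl fun d hd => by simp [hd]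
  have h6 : 0 ≤ ∑ d ∈ D, ∏ r ∈ d, (r : ℝ) :=
    Finset.sum_nonneg fun d _ => Finset.prod_nonneg fun r _ => by positivity
  have h7 : (∑ d ∈ D, ∏ r ∈ d, (r : ℝ)) * ∑ d ∈ D, ∏ r ∈ d, (r : ℝ) ≤ (R : ℝ) ^ 4 := by
    calc _ ≤ (R : ℝ) ^ 2 * (R : ℝ) ^ 2 := by gcongr
      _ = _ := by ring
  calc _ ≤ _ := h1
    _ = _ := h2
    _ ≤ _ := h3
    _ = _ := h5
    _ ≤ _ := by gcongr

/-- The completely multiplicative function `n ↦ c ^ k / n`, where `k` counts the prime factors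
of `n` in `S` with multiplicity. -/
noncomputable def weightHom (c : ℝ) (S : Finset ℕ) : ℕ →* ℝ where
  toFun n := (n : ℝ)⁻¹ * c ^ ∑ p ∈ S, n.factorization p
  map_one' := by simp
  map_mul' a b := by
    rcases eq_or_ne a 0 with rfl | ha
    · simp
    rcases eq_or_ne b 0 with rfl | hb
    · simp
    rw [Nat.factorization_mul ha hb]
    simp only [Finsupp.add_apply, Finset.sum_add_distrib, pow_add]
    push_cast
    rw [mul_inv]
    ring

theorem weightHom_apply (c : ℝ) (S : Finset ℕ) (n : ℕ) :
    weightHom c S n = (n : ℝ)⁻¹ * c ^ ∑ p ∈ S, n.factorization p := rfl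

theorem weightHom_nonneg {c : ℝ} (hc : 0 ≤ c) (S : Finset ℕ) (n : ℕ) : 0 ≤ weightHom c S n := by
  rw [weightHom_apply]; positivity

theorem weightHom_prime (c : ℝ) (S : Finset ℕ) {p : ℕ} (hp : p.Prime) :
    weightHom c S p = (if p ∈ S then c else 1) / p := by
  rw [weightHom_apply, hp.factorization]
  simp only [Finsupp.single_apply, Finset.sum_ite_eq]
  split_ifs <;> simp [div_eq_inv_mul]

/-- The sum of a completely multiplicative function over integers with prescribed support. -/
theorem sum_le_prod_of_primeFactors_eq (f : ℕ →* ℝ) (hf0 : ∀ n, 0 ≤ f n)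
    (hf1 : ∀ p, p.Prime → f p < 1) {d F : Finset ℕ}
    (hd : ∀ p ∈ d, p.Prime) (hF : ∀ n ∈ F, n ≠ 0 ∧ n.primeFactors = d) :
    ∑ n ∈ F, f n ≤ ∏ p ∈ d, f p / (1 - f p) := by
  have h1 := (EulerProduct.summable_and_hasSum_factoredNumbers_prod_filter_prime_geometric (f := f)
    (fun {p} hp => by rw [Real.norm_of_nonneg (hf0 p)]; exact hf1 p hp) d).2
  rw [Finset.filter_true_of_mem hd] at h1
  have hr : ∀ n ∈ F, ∏ p ∈ d, p ∣ n := fun n hn => by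
    rw [← (hF n hn).2]
    exact Nat.prod_primeFactors_dvd n
  have hr0 : 0 < ∏ p ∈ d, p := Finset.prod_pos fun p hp => (hd p hp).pos
  have hinj : Set.InjOn (fun n => n / ∏ p ∈ d, p) F := by
    intro a ha b hb h
    have := congrArg (· * ∏ p ∈ d, p) h
    simpa [Nat.div_mul_cancel (hr a ha), Nat.div_mul_cancel (hr b hb)] using this
  have h2 : ∑ n ∈ F, f n = (∏ p ∈ d, f p) * ∑ n ∈ F.image (fun n => n / ∏ p ∈ d, p), f n := by
    rw [Finset.sum_image hinj, Finset.mul_sum]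
    refine Finset.sum_congr rfl fun n hn => ?_
    rw [← map_prod, ← map_mul, Nat.mul_div_cancel' (hr n hn)]
  have h3 : ∀ n ∈ F.image (fun n => n / ∏ p ∈ d, p), n ∈ Nat.factoredNumbers d := by
    intro n hn
    obtain ⟨a, ha, rfl⟩ := Finset.mem_image.1 hn
    rw [Nat.mem_factoredNumbers']
    intro p hp hpn
    rw [← (hF a ha).2]
    exact Nat.mem_primeFactors.2 ⟨hp, hpn.trans (Nat.div_dvd_of_dvd (hr a ha)), (hF a ha).1⟩
  have h4 : ∑ n ∈ F.image (fun n => n / ∏ p ∈ d, p), f n ≤ ∏ p ∈ d, (1 - f p)⁻¹ := by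
    rw [← h1.tsum_eq, ← Finset.sum_subtype_of_mem (f := fun n => f n) h3]
    exact h1.summable.sum_le_tsum _ fun n _ => hf0 _
  rw [h2]
  calc _ ≤ (∏ p ∈ d, f p) * ∏ p ∈ d, (1 - f p)⁻¹ :=
        mul_le_mul_of_nonneg_left h4 (Finset.prod_nonneg fun p _ => hf0 p)
    _ = _ := by rw [← Finset.prod_mul_distrib]; rfl

theorem weightHom_two_lt_one {Q : Finset ℕ} (hQ : ∀ r ∈ Q, 5 ≤ r) {p : ℕ} (hp : p.Prime) :
    weightHom 2 Q p < 1 := by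
  have h := sieveRho_lt hQ hp
  have hp0 : (0 : ℝ) < p := by exact_mod_cast hp.pos
  rw [weightHom_prime 2 Q hp, div_lt_one hp0]
  exact h

theorem sieveH_eq_weightHom {Q : Finset ℕ} {p : ℕ} (hp : p.Prime) :
    sieveH Q p = weightHom 2 Q p / (1 - weightHom 2 Q p) := by
  have hp0 : (p : ℝ) ≠ 0 := by exact_mod_cast hp.ne_zero
  rw [weightHom_prime 2 Q hp, sieveH, one_sub_div hp0, div_div_div_cancel_right₀ hp0]
  rfl

theorem sum_weightHom_le_sum_prod_sieveH {Q : Finset ℕ} (hQ : ∀ r ∈ Q, 5 ≤ r) (R : ℕ) :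
    ∑ n ∈ Finset.Icc 1 R, weightHom 2 Q n
      ≤ ∑ d ∈ (Finset.Icc 1 R).image Nat.primeFactors, ∏ r ∈ d, sieveH Q r := by
  rw [← Finset.sum_fiberwise_of_maps_to (g := Nat.primeFactors)
    (fun n hn => Finset.mem_image_of_mem _ hn)]
  refine Finset.sum_le_sum fun d hd => ?_
  obtain ⟨n, hn, rfl⟩ := Finset.mem_image.1 hd
  refine (sum_le_prod_of_primeFactors_eq (weightHom 2 Q) (weightHom_nonneg zero_le_two Q)
    (fun p hp => weightHom_two_lt_one hQ hp) 
    (d := n.primeFactors) (fun _ => Nat.prime_of_mem_primeFactors) fun m hm => ?_).trans_eq ?_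
  · rw [Finset.mem_filter, Finset.mem_Icc] at hm
    exact ⟨by omega, hm.2⟩
  · exact Finset.prod_congr rfl fun p hp =>
      (sieveH_eq_weightHom (Nat.prime_of_mem_primeFactors hp)).symm

/-- The divisors of `n` all of whose prime factors lie in `Q` number at most `2 ^ k`, where `k`
counts the prime factors of `n` in `Q` with multiplicity. -/
theorem card_divisors_filter_le (Q : Finset ℕ) {n : ℕ} (hn : n ≠ 0) :
    ((n.divisors.filter fun e => ∀ p, p.Prime → p ∣ e → p ∈ Q).card : ℝ)
      ≤ n * weightHom 2 Q n := by
  induction n using induction_on_primes with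
  | zero => exact absurd rfl hn
  | one => simp [Finset.filter_singleton]; split_ifs <;> simp
  | prime_mul p a hp ih =>
    have ha : a ≠ 0 := right_ne_zero_of_mul hn
    specialize ih ha
    rw [map_mul, weightHom_prime 2 Q hp]
    have hp0 : (p : ℝ) ≠ 0 := by exact_mod_cast hp.ne_zero
    have h1 : ((p * a : ℕ) : ℝ) * ((if p ∈ Q then 2 else 1) / p * weightHom 2 Q a)
        = (if p ∈ Q then 2 else 1) * (a * weightHom 2 Q a) := by
      push_cast; field_simp
    rw [h1]
    set D := a.divisors.filter fun e => ∀ p, p.Prime → p ∣ e → p ∈ Q with hD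
    by_cases hpQ : p ∈ Q
    · rw [if_pos hpQ]
      have h2 : ((p * a).divisors.filter fun e => ∀ p, p.Prime → p ∣ e → p ∈ Q)
          ⊆ D ∪ D.image (p * ·) := by
        intro e he
        simp only [Finset.mem_filter, Nat.mem_divisors, Finset.mem_union, Finset.mem_image,
          hD] at he ⊢
        by_cases hpe : p ∣ e
        · obtain ⟨e', rfl⟩ := hpe
          exact Or.inr ⟨e', ⟨⟨Nat.dvd_of_mul_dvd_mul_left hp.pos he.1.1, ha⟩,
            fun q hq hqe => he.2 q hq (hqe.mul_left p)⟩, rfl⟩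
        · exact Or.inl ⟨⟨(((hp.coprime_iff_not_dvd).2 hpe).symm).dvd_of_dvd_mul_left he.1.1, ha⟩,
            he.2⟩
      have h3 := (Finset.card_le_card h2).trans ((Finset.card_union_le _ _).trans
        (Nat.add_le_add_left Finset.card_image_le _))
      have h4 : (_ : ℝ) ≤ _ := Nat.cast_le.2 h3
      push_cast at h4
      linarith
    · rw [if_neg hpQ, one_mul]
      refine le_trans ?_ ih
      rw [Nat.cast_le]
      refine Finset.card_le_card fun e he => ?_
      simp only [Finset.mem_filter, Nat.mem_divisors, hD] at he ⊢
      have hpe : ¬ p ∣ e := fun h => hpQ (he.2 p hp h)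
      exact ⟨⟨(((hp.coprime_iff_not_dvd).2 hpe).symm).dvd_of_dvd_mul_left he.1.1, ha⟩, he.2⟩

theorem sum_mul_sum_le_sum_weightHom (Q : Finset ℕ) (S : ℕ) :
    (∑ e ∈ (Finset.Icc 1 S).filter (fun e => ∀ p, p.Prime → p ∣ e → p ∈ Q), 1 / (e : ℝ)) *
      ∑ m ∈ Finset.Icc 1 S, 1 / (m : ℝ) ≤ ∑ n ∈ Finset.Icc 1 (S ^ 2), weightHom 2 Q n := by
  set E := (Finset.Icc 1 S).filter (fun e => ∀ p, p.Prime → p ∣ e → p ∈ Q) with hE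
  rw [Finset.sum_mul_sum, ← Finset.sum_product']
  rw [← Finset.sum_fiberwise_of_maps_to (t := Finset.Icc 1 (S ^ 2)) (g := fun x => x.1 * x.2)]
  · refine Finset.sum_le_sum fun n hn => ?_
    have hn1 : 1 ≤ n := (Finset.mem_Icc.1 hn).1
    have hn0 : (0 : ℝ) < n := by exact_mod_cast hn1
    have h1 : ∑ x ∈ (E ×ˢ Finset.Icc 1 S).filter (fun x => x.1 * x.2 = n),
        1 / (x.1 : ℝ) * (1 / (x.2 : ℝ))
        = ((E ×ˢ Finset.Icc 1 S).filter (fun x => x.1 * x.2 = n)).card * (1 / (n : ℝ)) := by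
      rw [← nsmul_eq_mul, ← Finset.sum_const]
      refine Finset.sum_congr rfl fun x hx => ?_
      rw [← (Finset.mem_filter.1 hx).2]
      push_cast
      rw [div_mul_div_comm, one_mul]
    rw [h1, mul_one_div, div_le_iff₀ hn0, mul_comm]
    refine le_trans ?_ (card_divisors_filter_le Q (by omega))
    rw [Nat.cast_le]
    refine Finset.card_le_card_of_injOn Prod.fst ?_ ?_
    · intro x hx
      simp only [Finset.coe_filter, Finset.mem_product, hE, Finset.mem_filter, Set.mem_ofPred_eq,
        Nat.mem_divisors] at hx ⊢
      exact ⟨⟨⟨x.2, hx.2.symm⟩, by omega⟩, hx.1.1.2⟩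
    · intro x hx y hy hxy
      simp only [Finset.coe_filter, Finset.mem_product, hE, Finset.mem_filter, Set.mem_ofPred_eq,
        Finset.mem_Icc] at hx hy
      refine Prod.ext hxy ?_
      have h2 : x.1 * x.2 = x.1 * y.2 := by rw [hx.2, hxy, hy.2]
      exact Nat.eq_of_mul_eq_mul_left (by omega) h2
  · intro x hx
    simp only [Finset.mem_product, hE, Finset.mem_filter, Finset.mem_Icc] at hx ⊢
    exact ⟨Nat.mul_pos (by omega) (by omega), by rw [sq]; exact Nat.mul_le_mul (by omega) (by omega)⟩

theorem exists_mul_eq_of_primes (P : ℕ → Prop) {n : ℕ} (hn : n ≠ 0) :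
    ∃ a b, a * b = n ∧ (∀ p, p.Prime → p ∣ a → ¬ P p) ∧ ∀ p, p.Prime → p ∣ b → P p := by
  induction n using induction_on_primes with
  | zero => exact absurd rfl hn
  | one =>
    exact ⟨1, 1, rfl, fun p hp h => absurd (Nat.dvd_one.1 h) hp.ne_one,
      fun p hp h => absurd (Nat.dvd_one.1 h) hp.ne_one⟩
  | prime_mul p n hp ih =>
    obtain ⟨a, b, h, ha, hb⟩ := ih (right_ne_zero_of_mul hn)
    by_cases hP : P p
    · refine ⟨a, p * b, by rw [← h]; ring, ha, fun q hq hqb => ?_⟩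
      rcases hq.dvd_mul.1 hqb with h1 | h1
      · rwa [(Nat.prime_dvd_prime_iff_eq hq hp).1 h1]
      · exact hb q hq h1
    · refine ⟨p * a, b, by rw [← h]; ring, fun q hq hqb => ?_, hb⟩
      rcases hq.dvd_mul.1 hqb with h1 | h1
      · rwa [(Nat.prime_dvd_prime_iff_eq hq hp).1 h1]
      · exact ha q hq h1

theorem sum_one_div_le_mul_prod {y z S : ℕ} :
    ∑ n ∈ Finset.Icc 1 (min S z), 1 / (n : ℝ)
      ≤ (∑ e ∈ (Finset.Icc 1 S).filter
          (fun e => ∀ p, p.Prime → p ∣ e → p ∈ (Finset.Ioc y z).filter Nat.Prime), 1 / (e : ℝ)) *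
        ∏ p ∈ y.primesLE, (1 - 1 / (p : ℝ))⁻¹ := by
  set E := (Finset.Icc 1 S).filter
    (fun e => ∀ p, p.Prime → p ∣ e → p ∈ (Finset.Ioc y z).filter Nat.Prime) with hE
  set F := (Finset.Icc 1 S).filter (fun e => ∀ p, p.Prime → p ∣ e → p ≤ y) with hF
  have h1 : ∑ m ∈ F, 1 / (m : ℝ) ≤ ∏ p ∈ y.primesLE, (1 - 1 / (p : ℝ))⁻¹ := by
    have h := sum_le_eulerProduct (weightHom 1 ∅) (weightHom_nonneg zero_le_one ∅)
      (fun p hp => by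
        rw [weightHom_prime _ _ hp]
        simpa using inv_lt_one_of_one_lt₀ (by exact_mod_cast hp.one_lt)) y F
      (fun n hn => ⟨by
        have := (Finset.mem_Icc.1 (Finset.mem_filter.1 hn).1).1
        omega, (Finset.mem_filter.1 hn).2⟩)
    simpa [weightHom_apply] using h
  have h2 : ∑ n ∈ Finset.Icc 1 (min S z), 1 / (n : ℝ)
      ≤ ∑ x ∈ E ×ˢ F, 1 / ((x.1 : ℝ) * x.2) := by
    have hch : ∀ n ∈ Finset.Icc 1 (min S z), ∃ x ∈ E ×ˢ F, x.1 * x.2 = n := by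
      intro n hn
      rw [Finset.mem_Icc] at hn
      obtain ⟨a, b, h, ha, hb⟩ := exists_mul_eq_of_primes (fun p => p ≤ y) (n := n) (by omega)
      have ha0 : 0 < a := Nat.pos_of_ne_zero (by rintro rfl; omega)
      have hb0 : 0 < b := Nat.pos_of_ne_zero (by rintro rfl; omega)
      have han : a ≤ n := h ▸ Nat.le_mul_of_pos_right a hb0
      have hbn : b ≤ n := h ▸ Nat.le_mul_of_pos_left b ha0
      refine ⟨(a, b), ?_, h⟩
      simp only [hE, hF, Finset.mem_product, Finset.mem_filter, Finset.mem_Icc, Finset.mem_Ioc]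
      refine ⟨⟨⟨ha0, by omega⟩, fun p hp hpa => ⟨⟨not_le.1 (ha p hp hpa), ?_⟩, hp⟩⟩,
        ⟨hb0, by omega⟩, hb⟩
      have := Nat.le_of_dvd ha0 hpa
      omega
    choose! g hg1 hg2 using hch
    have hinj : Set.InjOn g (Finset.Icc 1 (min S z)) := fun a ha b hb h => by
      rw [← hg2 a ha, ← hg2 b hb, h]
    calc _ = ∑ x ∈ (Finset.Icc 1 (min S z)).image g, 1 / ((x.1 : ℝ) * x.2) := by
          rw [Finset.sum_image hinj]
          refine Finset.sum_congr rfl fun n hn => ?_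
          rw [← Nat.cast_mul, hg2 n hn]
      _ ≤ _ := by
          refine Finset.sum_le_sum_of_subset_of_nonneg ?_ fun x _ _ => by positivity
          intro x hx
          obtain ⟨n, hn, rfl⟩ := Finset.mem_image.1 hx
          exact hg1 n hn
  refine h2.trans ?_
  rw [Finset.sum_product]
  calc _ = (∑ e ∈ E, 1 / (e : ℝ)) * ∑ m ∈ F, 1 / (m : ℝ) := by
        rw [Finset.sum_mul_sum]
        refine Finset.sum_congr rfl fun e _ => Finset.sum_congr rfl fun m _ => ?_
        rw [one_div_mul_one_div]
    _ ≤ _ := mul_le_mul_of_nonneg_left h1 (Finset.sum_nonneg fun e _ => by positivity)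

theorem log_le_sum_one_div (n : ℕ) : Real.log n ≤ ∑ m ∈ Finset.Icc 1 n, 1 / (m : ℝ) := by
  rcases Nat.eq_zero_or_pos n with rfl | hn
  · simp
  have h := log_add_one_le_harmonic n
  rw [harmonic_eq_sum_Icc] at h
  push_cast at h
  have h1 : Real.log n ≤ Real.log (n + 1 : ℝ) := Real.log_le_log (by exact_mod_cast hn) (by linarith)
  simp only [one_div]
  linarith

/-- Doubly exponential scale. -/
def dexp (j : ℕ) : ℕ := 2 ^ 2 ^ j

/-- `p - 1` has a prime factor in `(dexp (j - e), dexp j]`. -/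
def Hits (e j p : ℕ) : Prop := ∃ r, r.Prime ∧ dexp (j - e) < r ∧ r ≤ dexp j ∧ r ∣ p - 1

theorem dexp_pos (j : ℕ) : 0 < dexp j := by unfold dexp; positivity

theorem dexp_mono {i j : ℕ} (h : i ≤ j) : dexp i ≤ dexp j :=
  Nat.pow_le_pow_right two_pos (Nat.pow_le_pow_right two_pos h)

theorem two_le_dexp (j : ℕ) : 2 ≤ dexp j := dexp_mono (Nat.zero_le j)

theorem dexp_add (i k : ℕ) : dexp (i + k) = dexp i ^ 2 ^ k := by
  unfold dexp
  rw [← pow_mul, ← pow_add]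

theorem dexp_succ (i : ℕ) : dexp (i + 1) = dexp i ^ 2 := dexp_add i 1

theorem log_dexp (j : ℕ) : Real.log (dexp j) = 2 ^ j * Real.log 2 := by
  unfold dexp
  push_cast
  rw [Real.log_pow]
  push_cast
  ring

theorem log_dexp_pos (j : ℕ) : 0 < Real.log (dexp j) := by
  rw [log_dexp]
  have := Real.log_pos one_lt_two
  positivity

theorem exists_pow_le_lt {k : ℕ} (hk : k ≠ 0) (w : ℕ) : ∃ S : ℕ, S ^ k ≤ w ∧ w < (S + 1) ^ k := by
  refine ⟨Nat.findGreatest (fun s => s ^ k ≤ w) w, ?_, ?_⟩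
  · exact Nat.findGreatest_spec (P := fun s => s ^ k ≤ w) (Nat.zero_le w) (by simp [hk])
  · by_contra h
    push Not at h
    have h1 : Nat.findGreatest (fun s => s ^ k ≤ w) w + 1 ≤ w := (Nat.le_self_pow hk _).trans h
    have := Nat.le_findGreatest (P := fun s => s ^ k ≤ w) h1 h
    omega

theorem sum_range_one_div_le_log {N : ℕ} (hN : 1 ≤ N) (L : ℕ) :
    ∑ i ∈ Finset.range L, 1 / ((N + 1 + i : ℕ) : ℝ) ≤ Real.log ((N + L : ℕ) / N) := by
  have hN0 : (0 : ℝ) < N := by exact_mod_cast hN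
  induction L with
  | zero => simp [hN0.ne']
  | succ L ih =>
    rw [Finset.sum_range_succ]
    have hL0 : (0 : ℝ) < (N + L : ℕ) := by exact_mod_cast (by omega)
    have hL1 : (0 : ℝ) < (N + (L + 1) : ℕ) := by exact_mod_cast (by omega)
    have h := Real.one_sub_inv_le_log_of_pos (div_pos hL1 hL0)
    rw [Real.log_div hL0.ne' hN0.ne'] at ih
    rw [Real.log_div hL1.ne' hN0.ne']
    rw [Real.log_div hL1.ne' hL0.ne'] at h
    have h2 : 1 / ((N + 1 + L : ℕ) : ℝ) = 1 - (((N + (L + 1) : ℕ) : ℝ) / (N + L : ℕ))⁻¹ := by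
      rw [inv_div]
      push_cast at *
      field_simp
      ring
    linarith

theorem exists_sieve_sum_ge : ∃ C : ℝ, 0 < C ∧ ∀ y z S : ℕ, 4 ≤ y →
    Real.log (min S z : ℕ) * Real.log S ≤ C * Real.log y *
      ∑ d ∈ (Finset.Icc 1 (S ^ 2)).image Nat.primeFactors,
        ∏ r ∈ d, sieveH ((Finset.Ioc y z).filter Nat.Prime) r := by
  obtain ⟨C, hC, h⟩ := exists_prod_one_sub_inv_le
  refine ⟨C, hC, fun y z S hy => ?_⟩
  set Q := (Finset.Ioc y z).filter Nat.Prime with hQdef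
  have hQ : ∀ r ∈ Q, 5 ≤ r := fun r hr => by
    have := Finset.mem_Ioc.1 (Finset.mem_filter.1 hr).1
    omega
  set G := ∑ d ∈ (Finset.Icc 1 (S ^ 2)).image Nat.primeFactors, ∏ r ∈ d, sieveH Q r
  set Z := ∑ e ∈ (Finset.Icc 1 S).filter (fun e => ∀ p, p.Prime → p ∣ e → p ∈ Q), 1 / (e : ℝ)
  have hZ : 0 ≤ Z := Finset.sum_nonneg fun e _ => by positivity
  have h1 : Z * ∑ m ∈ Finset.Icc 1 S, 1 / (m : ℝ) ≤ G :=
    (sum_mul_sum_le_sum_weightHom Q S).trans (sum_weightHom_le_sum_prod_sieveH hQ _)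
  have h2 : Real.log (min S z : ℕ) ≤ Z * (C * Real.log y) :=
    (log_le_sum_one_div _).trans (sum_one_div_le_mul_prod.trans
      (mul_le_mul_of_nonneg_left (h y (by omega)) hZ))
  have h3 := log_le_sum_one_div S
  have hly : 0 ≤ Real.log y := Real.log_natCast_nonneg y
  calc _ ≤ Z * (C * Real.log y) * ∑ m ∈ Finset.Icc 1 S, 1 / (m : ℝ) :=
        mul_le_mul h2 h3 (Real.log_natCast_nonneg S) (by positivity)
    _ = C * Real.log y * (Z * ∑ m ∈ Finset.Icc 1 S, 1 / (m : ℝ)) := by ring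
    _ ≤ _ := by gcongr

set_option maxHeartbeats 600000 in
theorem exists_sum_not_hits_le : ∃ C : ℝ, 0 < C ∧ ∀ e j w w₂ : ℕ, e + 1 ≤ j → dexp j ≤ w →
    2 ^ 16 ≤ w → w ≤ w₂ →
    ∑ p ∈ (Finset.Ioc w w₂).filter (fun p => p.Prime ∧ ¬ Hits e j p), 1 / (p : ℝ)
      ≤ C / 2 ^ e * (Real.log (w₂ / w) / Real.log w) + 2 / √w := by
  obtain ⟨C, hC, hG⟩ := exists_sieve_sum_ge
  refine ⟨1024 * C, by positivity, fun e j w w₂ hj hjw hw hww => ?_⟩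
  obtain ⟨S, hS1, hS2⟩ := exists_pow_le_lt (k := 16) (by norm_num) w
  have hS : 2 ≤ S := by
    by_contra h
    have h1 : S + 1 ≤ 2 := by omega
    have := Nat.pow_le_pow_left h1 16
    omega
  have hy4 : 4 ≤ dexp (j - e) := dexp_mono (i := 1) (by omega)
  set Q := (Finset.Ioc (dexp (j - e)) (dexp j)).filter Nat.Prime with hQdef
  have hQ : ∀ r ∈ Q, 5 ≤ r := fun r hr => by
    have := Finset.mem_Ioc.1 (Finset.mem_filter.1 hr).1
    omega
  specialize hG (dexp (j - e)) (dexp j) S hy4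
  rw [← hQdef] at hG
  set D := (Finset.Icc 1 (S ^ 2)).image Nat.primeFactors with hDdef
  have hD : ∀ d ∈ D, (∀ r ∈ d, r.Prime) ∧ ∏ r ∈ d, r ≤ S ^ 2 := by
    intro d hd
    obtain ⟨n, hn, rfl⟩ := Finset.mem_image.1 hd
    rw [Finset.mem_Icc] at hn
    exact ⟨fun r => Nat.prime_of_mem_primeFactors,
      (Nat.le_of_dvd (by omega) (Nat.prod_primeFactors_dvd n)).trans hn.2⟩
  set G := ∑ d ∈ D, ∏ r ∈ d, sieveH Q r with hGdef
  have hG1 : 1 ≤ G := by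
    have h1 : (∅ : Finset ℕ) ∈ D :=
      Finset.mem_image.2 ⟨1, Finset.mem_Icc.2 ⟨le_rfl, Nat.one_le_pow _ _ (by omega)⟩, by simp⟩
    have := Finset.single_le_sum (f := fun d => ∏ r ∈ d, sieveH Q r)
      (fun d hd => Finset.prod_nonneg fun r hr => (sieveH_pos hQ ((hD d hd).1 r hr)).le) h1
    simpa using this
  have hw0 : (0 : ℝ) < w := by exact_mod_cast (by omega)
  have hlw : 0 < Real.log w := Real.log_pos (by exact_mod_cast (by omega))
  have hlS : Real.log w ≤ 32 * Real.log S := by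
    have h1 : w ≤ S ^ 32 := by
      have h2 : S + 1 ≤ S ^ 2 := by
        rw [sq]
        exact (by omega : S + 1 ≤ S * 2).trans (Nat.mul_le_mul_left S hS)
      calc w ≤ (S + 1) ^ 16 := hS2.le
        _ ≤ (S ^ 2) ^ 16 := Nat.pow_le_pow_left h2 16
        _ = S ^ 32 := by ring
    have h3 := Real.log_le_log hw0 ((Nat.cast_le (α := ℝ)).2 h1)
    rw [Nat.cast_pow, Real.log_pow] at h3
    exact_mod_cast h3
  have hlz : Real.log (dexp j) ≤ Real.log w :=
    Real.log_le_log (by exact_mod_cast dexp_pos j) (by exact_mod_cast hjw)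
  have hlzy : Real.log (dexp j) = 2 ^ e * Real.log (dexp (j - e)) := by
    rw [log_dexp, log_dexp, ← mul_assoc, ← pow_add]
    congr 2
    omega
  have hly := log_dexp_pos (j - e)
  have hmin : Real.log (dexp j) ≤ 32 * Real.log (min S (dexp j) : ℕ) := by
    rcases min_choice S (dexp j) with h | h <;> rw [h]
    · exact hlz.trans hlS
    · linarith [log_dexp_pos j]
  have hGlow : 2 ^ e * Real.log w ≤ 1024 * C * G := by
    have h1 : Real.log (dexp j) * Real.log w
        ≤ (32 * Real.log (min S (dexp j) : ℕ)) * (32 * Real.log S) :=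
      mul_le_mul hmin hlS hlw.le (by have := log_dexp_pos j; linarith)
    have h2 : Real.log (dexp (j - e)) * (2 ^ e * Real.log w)
        ≤ Real.log (dexp (j - e)) * (1024 * C * G) := by
      rw [hlzy] at h1
      calc _ = 2 ^ e * Real.log (dexp (j - e)) * Real.log w := by ring
        _ ≤ _ := h1
        _ = 1024 * (Real.log (min S (dexp j) : ℕ) * Real.log S) := by ring
        _ ≤ 1024 * (C * Real.log (dexp (j - e)) * G) := by gcongr
        _ = _ := by ring
    exact le_of_mul_le_mul_left h2 hly
  have hG0 : 0 < G := by linarith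
  obtain ⟨L, rfl⟩ := Nat.exists_eq_add_of_le hww
  set A := (Finset.range L).filter (fun i => (w + 1 + i).Prime ∧ ¬ Hits e j (w + 1 + i)) with hA
  have key := sieve_upper_bound hQ hD (N := w) (L := L) (A := A) (Finset.filter_subset _ _) (by
    intro i hi r hr hrR hbad
    obtain ⟨hp, hh⟩ := (Finset.mem_filter.1 hi).2
    rcases hbad with h | ⟨hrQ, h⟩
    · have h1 := (Nat.prime_dvd_prime_iff_eq hr hp).1 (Nat.dvd_of_mod_eq_zero h)
      have h2 : S ^ 2 ≤ S ^ 16 := Nat.pow_le_pow_right (by omega) (by norm_num)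
      omega
    · obtain ⟨h1, h2⟩ := Finset.mem_filter.1 hrQ
      rw [Finset.mem_Ioc] at h1
      refine hh ⟨r, h2, h1.1, h1.2, ?_⟩
      have := Nat.dvd_sub_mod (n := r) (w + 1 + i)
      rwa [h] at this)
  have hsum : ∑ p ∈ (Finset.Ioc w (w + L)).filter (fun p => p.Prime ∧ ¬ Hits e j p), 1 / (p : ℝ)
      = ∑ i ∈ A, 1 / ((w + 1 + i : ℕ) : ℝ) := by
    symm
    refine Finset.sum_bij (fun i _ => w + 1 + i) ?_ ?_ ?_ fun _ _ => rfl
    · intro i hi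
      simp only [hA, Finset.mem_filter, Finset.mem_range, Finset.mem_Ioc] at hi ⊢
      exact ⟨by omega, hi.2⟩
    · intro i _ i' _ h
      omega
    · intro p hp
      simp only [hA, Finset.mem_filter, Finset.mem_range, Finset.mem_Ioc] at hp ⊢
      have h : w + 1 + (p - w - 1) = p := by omega
      exact ⟨p - w - 1, ⟨by omega, by rw [h]; exact hp.2⟩, h⟩
  rw [hsum]
  have hV := sum_range_one_div_le_log (N := w) (by omega) L
  set V := ∑ i ∈ Finset.range L, 1 / ((w + 1 + i : ℕ) : ℝ) with hVdef
  set W := ∑ i ∈ A, 1 / ((w + 1 + i : ℕ) : ℝ) with hWdef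
  have hV0 : 0 ≤ V := Finset.sum_nonneg fun i _ => by positivity
  rw [← hGdef] at key
  have hE : 2 * ((S ^ 2 : ℕ) : ℝ) ^ 4 / (w + 1) ≤ 2 / √w := by
    have h1 : ((S : ℝ) ^ 8) ≤ √w := by
      apply Real.le_sqrt_of_sq_le
      rw [← pow_mul]
      exact_mod_cast hS1
    have h2 : 0 < √(w : ℝ) := Real.sqrt_pos.2 hw0
    rw [div_le_div_iff₀ (by linarith) h2]
    push_cast
    calc 2 * ((S : ℝ) ^ 2) ^ 4 * √w = 2 * (S ^ 8 * √w) := by ring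
      _ ≤ 2 * (√w * √w) := by gcongr
      _ = 2 * w := by rw [Real.mul_self_sqrt hw0.le]
      _ ≤ _ := by linarith
  have h1 : W ≤ V / G + 2 / √w := by
    have h2 : W ≤ V / G + 2 / √w / G ^ 2 := by
      have h3 : W * G ^ 2 ≤ (V / G + 2 / √w / G ^ 2) * G ^ 2 := by
        calc _ ≤ _ := key
          _ ≤ G * V + 2 / √w := by gcongr
          _ = _ := by field_simp
      exact le_of_mul_le_mul_right h3 (by positivity)
    exact h2.trans (add_le_add_right
      (div_le_self (a := 2 / √(w : ℝ)) (by positivity) (one_le_pow₀ hG1)) _)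
  refine h1.trans ?_
  gcongr
  calc V / G ≤ Real.log ((w + L : ℕ) / w) / G := by gcongr
    _ ≤ Real.log ((w + L : ℕ) / w) / (2 ^ e * Real.log w / (1024 * C)) := by
        gcongr
        · exact hV0.trans hV
        · rw [div_le_iff₀ (by positivity)]; linarith
    _ = _ := by field_simp

theorem sum_prime_eq_hits_add (e j w w₂ : ℕ) :
    ∑ p ∈ (Finset.Ioc w w₂).filter Nat.Prime, 1 / (p : ℝ)
      = ∑ p ∈ (Finset.Ioc w w₂).filter (fun p => p.Prime ∧ Hits e j p), 1 / (p : ℝ)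
        + ∑ p ∈ (Finset.Ioc w w₂).filter (fun p => p.Prime ∧ ¬ Hits e j p), 1 / (p : ℝ) := by
  rw [← Finset.filter_filter, ← Finset.filter_filter, Finset.sum_filter_add_sum_filter_not]

theorem tendsto_dexp : Tendsto dexp atTop atTop :=
  tendsto_atTop_mono (fun _ => (Nat.lt_two_pow_self.trans Nat.lt_two_pow_self).le) tendsto_id

theorem tendsto_log_natCast : Tendsto (fun n : ℕ => Real.log n) atTop atTop :=
  Real.tendsto_log_atTop.comp tendsto_natCast_atTop_atTop

theorem tendsto_two_div_sqrt : Tendsto (fun n : ℕ => 2 / √(n : ℝ)) atTop (nhds 0) :=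
  (Real.tendsto_sqrt_atTop.comp tendsto_natCast_atTop_atTop).const_div_atTop 2

/-- Most primes hit every scale, once the width `e` of the scales is large enough. -/
theorem exists_hits_scale : ∃ e i₀ : ℕ, e + 1 ≤ i₀ ∧
    (∀ i j, i₀ ≤ j → j ≤ i → 1 / 4 ≤
      ∑ p ∈ (Finset.Ioc (dexp i) (dexp (i + 1))).filter (fun p => p.Prime ∧ Hits e j p),
        1 / (p : ℝ)) ∧
    ∀ a : ℕ, 1 ≤ a → ∀ᶠ u : ℕ in atTop,
      1 / (2 * (a + 1 : ℝ)) ≤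
        ∑ p ∈ (Finset.Ioc (u ^ a) (u ^ (a + 1))).filter Nat.Prime, 1 / (p : ℝ) ∧
      ∀ j, i₀ ≤ j → dexp j ≤ u ^ a →
        ∑ p ∈ (Finset.Ioc (u ^ a) (u ^ (a + 1))).filter (fun p => p.Prime ∧ ¬ Hits e j p),
          1 / (p : ℝ)
        ≤ (∑ p ∈ (Finset.Ioc (u ^ a) (u ^ (a + 1))).filter Nat.Prime, 1 / (p : ℝ)) / 16 := by
  obtain ⟨C, hC, hsieve⟩ := exists_sum_not_hits_le
  obtain ⟨C', hC', hlow⟩ := exists_sum_inv_prime_Ioc_ge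
  obtain ⟨e, he⟩ : ∃ e : ℕ, C / 2 ^ e ≤ 1 / 128 := by
    obtain ⟨e, he⟩ := pow_unbounded_of_one_lt (128 * C) (one_lt_two (α := ℝ))
    refine ⟨e, ?_⟩
    rw [div_le_div_iff₀ (by positivity) (by norm_num)]
    linarith
  obtain ⟨i₁, hi₁⟩ := eventually_atTop.1 ((tendsto_two_div_sqrt.comp tendsto_dexp).eventually
    (ge_mem_nhds (show (0 : ℝ) < 1 / 128 by norm_num)))
  obtain ⟨i₂, hi₂⟩ := eventually_atTop.1 ((tendsto_log_natCast.comp tendsto_dexp).eventually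
    (eventually_ge_atTop (8 * C')))
  refine ⟨e, max (e + 1) (max 4 (max i₁ i₂)), le_max_left _ _, ?_, ?_⟩
  · intro i j hj hij
    simp only [max_le_iff] at hj
    obtain ⟨h1, h2, h3, h4⟩ := hj
    have h5 := hsieve e j (dexp i) (dexp (i + 1)) h1 (dexp_mono hij)
      (dexp_mono (i := 4) (by omega)) (dexp_mono (by omega))
    have h6 := hlow (dexp i) (dexp (i + 1)) (dexp_pos i) (dexp_mono (by omega)) (two_le_dexp _)
    have hl := log_dexp_pos i
    have hi0 : (dexp i : ℝ) ≠ 0 := by exact_mod_cast (dexp_pos i).ne'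
    have h7 : Real.log (dexp (i + 1)) = 2 * Real.log (dexp i) := by
      rw [dexp_succ, Nat.cast_pow, Real.log_pow]; norm_num
    have h8 : Real.log ((dexp (i + 1) : ℕ) / (dexp i : ℝ)) / Real.log (dexp i) = 1 := by
      rw [dexp_succ, Nat.cast_pow, sq, mul_div_assoc, div_self hi0, mul_one, div_self hl.ne']
    rw [h8, mul_one] at h5
    rw [h7, sum_prime_eq_hits_add e j] at h6
    have h9 : 7 / 16 ≤ (2 * Real.log (dexp i) - Real.log (dexp i) - C')
        / (2 * Real.log (dexp i)) := by
      rw [le_div_iff₀ (by linarith)]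
      have := hi₂ i (by omega)
      simp only [Function.comp_apply] at this
      linarith
    have h10 := hi₁ i (by omega)
    simp only [Function.comp_apply] at h10
    linarith
  · intro a ha
    have ha0 : (1 : ℝ) ≤ a := by exact_mod_cast ha
    have hpa : (0 : ℝ) < 1 / (64 * (a + 1)) := by positivity
    filter_upwards [tendsto_two_div_sqrt.eventually (ge_mem_nhds hpa),
      tendsto_log_natCast.eventually (eventually_ge_atTop (2 * C')),
      eventually_ge_atTop (2 ^ 16)] with u hu1 hu2 hu3
    have hu0 : (0 : ℝ) < u := by exact_mod_cast (by omega)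
    have hl : 0 < Real.log u := by linarith
    have huu : u ≤ u ^ a := Nat.le_self_pow (by omega) u
    have hle : u ^ a ≤ u ^ (a + 1) := Nat.pow_le_pow_right (by omega) (by omega)
    have hμ : 1 / (2 * (a + 1 : ℝ)) ≤
        ∑ p ∈ (Finset.Ioc (u ^ a) (u ^ (a + 1))).filter Nat.Prime, 1 / (p : ℝ) := by
      refine le_trans ?_ (hlow (u ^ a) (u ^ (a + 1)) (by omega) hle (by omega))
      rw [Nat.cast_pow, Nat.cast_pow, Real.log_pow, Real.log_pow]
      push_cast
      rw [div_le_div_iff₀ (by positivity) (by positivity)]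
      have : 0 ≤ (a + 1 : ℝ) * (Real.log u - 2 * C') := by
        apply mul_nonneg <;> linarith
      linarith
    refine ⟨hμ, fun j hj hju => ?_⟩
    have h5 := hsieve e j (u ^ a) (u ^ (a + 1)) (le_trans (le_max_left _ _) hj) hju
      (by omega) hle
    refine h5.trans ?_
    have h8 : Real.log ((u ^ (a + 1) : ℕ) / (u ^ a : ℕ)) / Real.log (u ^ a : ℕ) = 1 / a := by
      rw [Nat.cast_pow, Nat.cast_pow, Real.log_pow, pow_succ, mul_comm, mul_div_assoc,
        div_self (by positivity), mul_one]
      field_simp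
    rw [h8]
    have h9 : 2 / √((u ^ a : ℕ) : ℝ) ≤ 2 / √(u : ℝ) := by
      have : 0 < √(u : ℝ) := Real.sqrt_pos.2 hu0
      gcongr
    have h10 : C / 2 ^ e * (1 / a) ≤ 1 / 128 * (2 / (a + 1)) := by
      have : 1 / (a : ℝ) ≤ 2 / (a + 1) := by
        rw [div_le_div_iff₀ (by positivity) (by positivity)]; linarith
      gcongr
    have h11 : (1 : ℝ) / 128 * (2 / (a + 1)) + 1 / (64 * (a + 1)) = 1 / (2 * (a + 1)) / 16 := by
      field_simp
      norm_num
    linarith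

theorem sum_filter_exists_le {α ι : Type*} (s : Finset α) (X : Finset ι) (P : ι → α → Prop)
    [DecidablePred fun a => ∃ x ∈ X, P x a] [∀ x, DecidablePred (P x)] {w : α → ℝ} (hw : ∀ a ∈ s, 0 ≤ w a) :
    ∑ a ∈ s.filter (fun a => ∃ x ∈ X, P x a), w a ≤ ∑ x ∈ X, ∑ a ∈ s.filter (P x), w a := by
  simp only [Finset.sum_filter]
  rw [Finset.sum_comm]
  refine Finset.sum_le_sum fun a ha => ?_
  have h0 : ∀ x ∈ X, 0 ≤ if P x a then w a else 0 := fun x _ => by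
    split_ifs
    exacts [hw a ha, le_rfl]
  split_ifs with h
  · obtain ⟨x, hx, hxa⟩ := h
    have := Finset.single_le_sum h0 hx
    rwa [if_pos hxa] at this
  · exact Finset.sum_nonneg h0

theorem sum_one_div_le_one_add_log (n : ℕ) :
    ∑ m ∈ Finset.Icc 1 n, 1 / (m : ℝ) ≤ 1 + Real.log n := by
  have h := harmonic_le_one_add_log n
  rw [harmonic_eq_sum_Icc] at h
  push_cast at h
  simpa only [one_div] using h

theorem sum_congr_one_le {F : Finset ℕ} {z r : ℕ} (hF : F ⊆ Finset.Icc 2 z) (hr : 1 ≤ r) :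
    ∑ p ∈ F, (if r ∣ p - 1 then 1 / (p : ℝ) else 0) ≤ (1 + Real.log z) / r := by
  have hr0 : (0 : ℝ) < r := by exact_mod_cast hr
  rw [← Finset.sum_filter]
  have h1 : ∑ p ∈ F.filter (fun p => r ∣ p - 1), 1 / (p : ℝ)
      ≤ ∑ p ∈ F.filter (fun p => r ∣ p - 1), 1 / (((p - 1) / r : ℕ) : ℝ) / r := by
    refine Finset.sum_le_sum fun p hp => ?_
    obtain ⟨hpF, n, hn⟩ := Finset.mem_filter.1 hp
    have hp2 := (Finset.mem_Icc.1 (hF hpF)).1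
    have hn0 : 0 < n := Nat.pos_of_ne_zero (by rintro rfl; omega)
    have hn0' : (0 : ℝ) < n := by exact_mod_cast hn0
    rw [hn, Nat.mul_div_cancel_left _ hr, div_div]
    refine one_div_le_one_div_of_le (by positivity) ?_
    have : n * r ≤ p := by rw [mul_comm]; omega
    exact_mod_cast this
  refine h1.trans ?_
  rw [← Finset.sum_div]
  refine div_le_div_of_nonneg_right ?_ hr0.le
  have hinj : Set.InjOn (fun p => (p - 1) / r) (F.filter (fun p => r ∣ p - 1)) := by
    intro p hp q hq h
    obtain ⟨hpF, hp1⟩ := Finset.mem_filter.1 hp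
    obtain ⟨hqF, hq1⟩ := Finset.mem_filter.1 hq
    have hp2 := (Finset.mem_Icc.1 (hF hpF)).1
    have hq2 := (Finset.mem_Icc.1 (hF hqF)).1
    have h2 : (p - 1) / r * r = (q - 1) / r * r := congrArg (· * r) h
    rw [Nat.div_mul_cancel hp1, Nat.div_mul_cancel hq1] at h2
    omega
  rw [← Finset.sum_image (f := fun n : ℕ => 1 / (n : ℝ)) hinj]
  refine le_trans (Finset.sum_le_sum_of_subset_of_nonneg ?_ fun _ _ _ => by positivity)
    (sum_one_div_le_one_add_log z)
  intro n hn
  obtain ⟨p, hp, rfl⟩ := Finset.mem_image.1 hn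
  obtain ⟨hpF, k, hk⟩ := Finset.mem_filter.1 hp
  have hp2 := Finset.mem_Icc.1 (hF hpF)
  have hk0 : 0 < k := Nat.pos_of_ne_zero (by rintro rfl; omega)
  have : k ≤ r * k := Nat.le_mul_of_pos_left k hr
  simp only [hk, Nat.mul_div_cancel_left _ hr, Finset.mem_Icc]
  omega

theorem sum_sq_congr_one_le {F : Finset ℕ} {y z Y : ℕ} (hF : F ⊆ Finset.Icc 2 z) (hy : 1 ≤ y) :
    ∑ r ∈ Finset.Ioc y Y, (∑ p ∈ F, (if r ∣ p - 1 then 1 / (p : ℝ) else 0)) ^ 2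
      ≤ (1 + Real.log z) ^ 2 / y := by
  have hlz := Real.log_natCast_nonneg z
  calc _ ≤ ∑ r ∈ Finset.Ioc y Y, ((1 + Real.log z) / r) ^ 2 := by
        refine Finset.sum_le_sum fun r hr => ?_
        refine pow_le_pow_left₀ (Finset.sum_nonneg fun p _ => by positivity)
          (sum_congr_one_le hF ?_) 2
        have := (Finset.mem_Ioc.1 hr).1
        omega
    _ = (1 + Real.log z) ^ 2 * ∑ r ∈ Finset.Ioc y Y, ((r : ℝ) ^ 2)⁻¹ := by
        rw [Finset.mul_sum]
        exact Finset.sum_congr rfl fun r _ => by rw [div_pow, div_eq_mul_inv]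
    _ ≤ (1 + Real.log z) ^ 2 * (y : ℝ)⁻¹ := by
        gcongr
        rcases le_or_gt y Y with h | h
        · refine (sum_Ioc_inv_sq_le_sub (by omega) h).trans ?_
          have : (0 : ℝ) ≤ (Y : ℝ)⁻¹ := by positivity
          linarith
        · rw [Finset.Ioc_eq_empty (by omega)]
          simp
    _ = _ := by rw [div_eq_mul_inv]

/-- Many distinct primes from the `j`-th scale divide `p - 1` for primes `p ∣ n`. -/
def GoodAt (e J j n : ℕ) : Prop := ∃ T : Finset ℕ, J ≤ T.card ∧ ∀ r ∈ T, r.Prime ∧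
  dexp (j - e) < r ∧ r ≤ dexp j ∧ ∃ p, p.Prime ∧ p ∣ n ∧ r ∣ p - 1

theorem GoodAt.of_dvd {e J j m n : ℕ} (h : GoodAt e J j m) (hmn : m ∣ n) : GoodAt e J j n := by
  obtain ⟨T, hT, h⟩ := h
  refine ⟨T, hT, fun r hr => ?_⟩
  obtain ⟨h1, h2, h3, p, hp, hpm, hrp⟩ := h r hr
  exact ⟨h1, h2, h3, p, hp, hpm.trans hmn, hrp⟩

theorem goodAt_of_forall_not_dvd {e J j m : ℕ} {S : Finset ℕ} (hm : m ≠ 0)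
    (hS : ∀ p ∈ S, p.Prime ∧ Hits e j p) (hJ : J ≤ ∑ p ∈ S, m.factorization p)
    (h : ∀ r ∈ Finset.Ioc (dexp (j - e)) (dexp j), ∀ p ∈ S, ∀ p' ∈ S,
      r ∣ p - 1 → r ∣ p' - 1 → ¬ p * p' ∣ m) : GoodAt e J j m := by
  have hch : ∀ p ∈ S, ∃ r, r.Prime ∧ dexp (j - e) < r ∧ r ≤ dexp j ∧ r ∣ p - 1 :=
    fun p hp => (hS p hp).2
  choose! g hg1 hg2 hg3 hg4 using hch
  have hv : ∀ p ∈ S, m.factorization p ≤ if p ∣ m then 1 else 0 := by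
    intro p hp
    have hpp := (hS p hp).1
    split_ifs with hd
    · by_contra hc
      refine h (g p) (Finset.mem_Ioc.2 ⟨hg2 p hp, hg3 p hp⟩) p hp p hp (hg4 p hp) (hg4 p hp) ?_
      rw [← sq]
      exact (hpp.pow_dvd_iff_le_factorization hm).2 (by omega)
    · rw [Nat.factorization_eq_zero_of_not_dvd hd]
  refine ⟨(S.filter (· ∣ m)).image g, ?_, ?_⟩
  · rw [Finset.card_image_of_injOn]
    · refine hJ.trans ((Finset.sum_le_sum hv).trans_eq ?_)
      rw [← Finset.sum_filter, Finset.card_eq_sum_ones]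
    · intro p hp q hq hpq
      obtain ⟨hpS, hpm⟩ := Finset.mem_filter.1 hp
      obtain ⟨hqS, hqm⟩ := Finset.mem_filter.1 hq
      by_contra hne
      refine h (g p) (Finset.mem_Ioc.2 ⟨hg2 p hpS, hg3 p hpS⟩) p hpS q hqS (hg4 p hpS)
        (by have := hg4 q hqS; rwa [← hpq] at this) ?_
      exact Nat.Coprime.mul_dvd_of_dvd_of_dvd
        ((Nat.coprime_primes (hS p hpS).1 (hS q hqS).1).2 hne) hpm hqm
  · intro r hr
    obtain ⟨p, hp, rfl⟩ := Finset.mem_image.1 hr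
    obtain ⟨hpS, hpm⟩ := Finset.mem_filter.1 hp
    exact ⟨hg1 p hpS, hg2 p hpS, hg3 p hpS, p, (hS p hpS).1, hpm, hg4 p hpS⟩

theorem sum_few_prime_factors_le {M : ℕ} {S : Finset ℕ} (hS : S ⊆ M.primesLE) (J : ℕ) :
    ∑ m ∈ (Finset.Icc 1 M).filter (fun m => ∑ p ∈ S, m.factorization p < J), 1 / (m : ℝ)
      ≤ 2 ^ J * ((∏ p ∈ M.primesLE, (1 - 1 / (p : ℝ))⁻¹) *
        Real.exp (-(∑ p ∈ S, 1 / (p : ℝ)) / 2)) := by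
  have hP : ∀ p ∈ M.primesLE, (2 : ℝ) ≤ p := fun p hp => by
    exact_mod_cast (Nat.mem_primesLE.1 hp).2.two_le
  have h1 : ∑ m ∈ (Finset.Icc 1 M).filter (fun m => ∑ p ∈ S, m.factorization p < J), 1 / (m : ℝ)
      ≤ ∑ m ∈ Finset.Icc 1 M, 2 ^ J * weightHom (1 / 2) S m := by
    rw [Finset.sum_filter]
    refine Finset.sum_le_sum fun m _ => ?_
    have h0 := weightHom_nonneg (c := 1 / 2) (by norm_num) S m
    split_ifs with h
    · rw [weightHom_apply, one_div, mul_comm, mul_assoc]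
      have h2 : (1 : ℝ) ≤ (1 / 2) ^ (∑ p ∈ S, m.factorization p) * 2 ^ J := by
        rw [one_div, inv_pow, inv_mul_eq_div, one_le_div (by positivity)]
        exact pow_le_pow_right₀ one_le_two h.le
      exact le_mul_of_one_le_right (by positivity) h2
    · positivity
  refine h1.trans ?_
  rw [← Finset.mul_sum]
  refine mul_le_mul_of_nonneg_left ?_ (by positivity)
  refine (sum_le_eulerProduct (weightHom (1 / 2) S) (weightHom_nonneg (by norm_num) S)
    (fun p hp => ?_) M _ fun n hn => ?_).trans ?_
  · rw [weightHom_prime _ _ hp, div_lt_one (by exact_mod_cast hp.pos)]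
    have : (1 : ℝ) < p := by exact_mod_cast hp.one_lt
    split_ifs <;> linarith
  · rw [Finset.mem_Icc] at hn
    exact ⟨by omega, fun p _ hpn => (Nat.le_of_dvd (by omega) hpn).trans hn.2⟩
  · have h3 : Real.exp (-(∑ p ∈ S, 1 / (p : ℝ)) / 2)
        = ∏ p ∈ M.primesLE, (if p ∈ S then Real.exp (-(1 / (2 * (p : ℝ)))) else 1) := by
      rw [Finset.prod_ite_mem, Finset.inter_eq_right.2 hS, ← Real.exp_sum]
      congr 1
      rw [Finset.sum_neg_distrib, neg_div, Finset.sum_div]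
      congr 1
      exact Finset.sum_congr rfl fun p _ => by rw [div_div, mul_comm]
    rw [h3, ← Finset.prod_mul_distrib]
    refine Finset.prod_le_prod (fun p hp => ?_) fun p hp => ?_
    · have hp2 := hP p hp
      rw [inv_nonneg, sub_nonneg, weightHom_prime _ _ (Nat.mem_primesLE.1 hp).2,
        div_le_one (by linarith)]
      split_ifs <;> linarith
    · have hp2 := hP p hp
      rw [weightHom_prime _ _ (Nat.mem_primesLE.1 hp).2]
      split_ifs with h
      · have hx : 1 / (p : ℝ) ≤ 1 / 2 := one_div_le_one_div_of_le (by norm_num) hp2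
        have hx0 : 0 < 1 / (p : ℝ) := by positivity
        have he : (1 : ℝ) / 2 / p = 1 / p / 2 := by ring
        have he2 : 1 / (2 * (p : ℝ)) = 1 / p / 2 := by field_simp
        rw [he, he2]
        set x := 1 / (p : ℝ)
        have h4 := Real.add_one_le_exp (-(x / 2))
        have h5 : 0 < 1 - x := by linarith
        have h6 : 0 < 1 - x / 2 := by linarith
        rw [inv_mul_eq_div, le_div_iff₀ h5, inv_mul_eq_div, div_le_iff₀ h6]
        nlinarith
      · simp

theorem sum_exists_mul_dvd_le {M y Y z : ℕ} {S : Finset ℕ} (hS : S ⊆ Finset.Icc 2 z)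
    (hy : 1 ≤ y) :
    ∑ m ∈ (Finset.Icc 1 M).filter (fun m => ∃ x ∈ Finset.Ioc y Y ×ˢ S ×ˢ S,
        x.1 ∣ x.2.1 - 1 ∧ x.1 ∣ x.2.2 - 1 ∧ x.2.1 * x.2.2 ∣ m), 1 / (m : ℝ)
      ≤ (1 + Real.log z) ^ 2 / y * ∑ m ∈ Finset.Icc 1 M, 1 / (m : ℝ) := by
  set H := ∑ m ∈ Finset.Icc 1 M, 1 / (m : ℝ) with hH
  have hH0 : 0 ≤ H := Finset.sum_nonneg fun m _ => by positivity
  have hd : ∀ a : ℕ, 0 < a →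
      ∑ m ∈ (Finset.Icc 1 M).filter (fun m => a ∣ m), 1 / (m : ℝ) ≤ 1 / a * H := by
    intro a ha
    rw [hH, Finset.mul_sum]
    have hsub : (Finset.Icc 1 M).filter (fun m => a ∣ m) ⊆ (Finset.Icc 1 M).image (a * ·) := by
      intro m hm
      obtain ⟨h1, k, rfl⟩ := Finset.mem_filter.1 hm
      rw [Finset.mem_Icc] at h1
      have hk : 0 < k := Nat.pos_of_ne_zero (by rintro rfl; omega)
      have : k ≤ a * k := Nat.le_mul_of_pos_left k ha
      exact Finset.mem_image.2 ⟨k, Finset.mem_Icc.2 ⟨hk, by omega⟩, rfl⟩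
    refine (Finset.sum_le_sum_of_subset_of_nonneg hsub fun _ _ _ => by positivity).trans_eq ?_
    rw [Finset.sum_image fun x _ y _ h => Nat.eq_of_mul_eq_mul_left ha h]
    refine Finset.sum_congr rfl fun m _ => ?_
    push_cast
    rw [one_div_mul_one_div]
  refine (sum_filter_exists_le _ _ (fun (x : ℕ × ℕ × ℕ) m =>
    x.1 ∣ x.2.1 - 1 ∧ x.1 ∣ x.2.2 - 1 ∧ x.2.1 * x.2.2 ∣ m) fun m _ => by positivity).trans ?_
  have h1 : ∀ x ∈ Finset.Ioc y Y ×ˢ S ×ˢ S, ∑ m ∈ (Finset.Icc 1 M).filter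
      (fun m => x.1 ∣ x.2.1 - 1 ∧ x.1 ∣ x.2.2 - 1 ∧ x.2.1 * x.2.2 ∣ m), 1 / (m : ℝ)
      ≤ ((if x.1 ∣ x.2.1 - 1 then 1 / (x.2.1 : ℝ) else 0) *
        (if x.1 ∣ x.2.2 - 1 then 1 / (x.2.2 : ℝ) else 0)) * H := by
    intro x hx
    simp only [Finset.mem_product] at hx
    by_cases ha : x.1 ∣ x.2.1 - 1
    · by_cases hb : x.1 ∣ x.2.2 - 1
      · simp only [ha, hb, true_and, if_true]
        refine (hd (x.2.1 * x.2.2) ?_).trans_eq ?_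
        · have h2 := (Finset.mem_Icc.1 (hS hx.2.1)).1
          have h3 := (Finset.mem_Icc.1 (hS hx.2.2)).1
          exact Nat.mul_pos (by omega) (by omega)
        · push_cast
          rw [one_div_mul_one_div]
      · simp [hb]
    · simp [ha]
  refine (Finset.sum_le_sum h1).trans ?_
  rw [← Finset.sum_mul]
  refine mul_le_mul_of_nonneg_right ?_ hH0
  refine le_trans (le_of_eq ?_) (sum_sq_congr_one_le (Y := Y) hS hy)
  rw [Finset.sum_product]
  refine Finset.sum_congr rfl fun r _ => ?_
  rw [sq, Finset.sum_mul_sum, Finset.sum_product]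

theorem exists_forall_sum_le_of_summable {g : ℕ → ℝ} (hg : Summable g) {ε : ℝ} (hε : 0 < ε) :
    ∃ N : ℕ, ∀ s : Finset ℕ, (∀ j ∈ s, N ≤ j) → ∑ j ∈ s, g j ≤ ε := by
  obtain ⟨s, hs⟩ := summable_iff_vanishing_norm.1 hg ε hε
  refine ⟨s.sup id + 1, fun t ht => (le_abs_self _).trans (hs t ?_).le⟩
  rw [Finset.disjoint_left]
  intro j hjt hjs
  have h1 := ht j hjt
  have h2 : j ≤ s.sup id := Finset.le_sup (f := id) hjs
  omega

theorem dexp_sub_ge {e j : ℕ} (hej : e ≤ j) :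
    (Real.log 2 / 2 ^ e) ^ 6 / 720 * (4 : ℝ) ^ (3 * j) ≤ dexp (j - e) := by
  have h1 := Real.pow_div_factorial_le_exp (x := 2 ^ (j - e) * Real.log 2)
    (by have := Real.log_pos one_lt_two; positivity) 6
  have h2 : Real.exp (2 ^ (j - e) * Real.log 2) = dexp (j - e) := by
    rw [← log_dexp, Real.exp_log (by exact_mod_cast dexp_pos _)]
  rw [h2] at h1
  refine le_trans (le_of_eq ?_) h1
  have h3 : (2 : ℝ) ^ (j - e) = 2 ^ j / 2 ^ e := by
    rw [eq_div_iff (by positivity), ← pow_add, Nat.sub_add_cancel hej]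
  have h4 : (4 : ℝ) ^ (3 * j) = (2 ^ j) ^ 6 := by
    rw [← pow_mul, show (4 : ℝ) = 2 ^ 2 by norm_num, ← pow_mul]
    congr 1; ring
  have h5 : ((6 : ℕ).factorial : ℝ) = 720 := by norm_num [Nat.factorial]
  rw [h3, h4, h5]
  field_simp

theorem sum_hits_windows_ge {e i₀ : ℕ}
    (hB : ∀ i j, i₀ ≤ j → j ≤ i → 1 / 4 ≤
      ∑ p ∈ (Finset.Ioc (dexp i) (dexp (i + 1))).filter (fun p => p.Prime ∧ Hits e j p),
        1 / (p : ℝ)) {j : ℕ} (hj : i₀ ≤ j) (T : ℕ) :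
    T / 4 ≤ ∑ p ∈ (Finset.Ioc (dexp j) (dexp (j + T))).filter
      (fun p => p.Prime ∧ Hits e j p), 1 / (p : ℝ) := by
  induction T with
  | zero => simp
  | succ T ih =>
    have h1 := hB (j + T) j hj (by omega)
    have h2 : Finset.Ioc (dexp j) (dexp (j + (T + 1)))
        = Finset.Ioc (dexp j) (dexp (j + T)) ∪ Finset.Ioc (dexp (j + T)) (dexp (j + T + 1)) :=
      (Finset.Ioc_union_Ioc_eq_Ioc (dexp_mono (by omega)) (dexp_mono (by omega))).symm
    rw [h2, Finset.filter_union, Finset.sum_union]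
    · push_cast
      linarith
    · refine Finset.disjoint_filter_filter ?_
      rw [Finset.disjoint_left]
      intro p hp hp'
      rw [Finset.mem_Ioc] at hp hp'
      omega

theorem exists_sum_not_goodAt_le {e i₀ : ℕ} (hei : e + 1 ≤ i₀)
    (hB : ∀ i j, i₀ ≤ j → j ≤ i → 1 / 4 ≤
      ∑ p ∈ (Finset.Ioc (dexp i) (dexp (i + 1))).filter (fun p => p.Prime ∧ Hits e j p),
        1 / (p : ℝ)) (J : ℕ) :
    ∃ g : ℕ → ℝ, Summable g ∧ ∀ t j, i₀ ≤ j → j ≤ t →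
      ∑ m ∈ (Finset.Icc 1 (dexp t)).filter (fun m => ¬ GoodAt e J j m), 1 / (m : ℝ)
        ≤ Real.log (dexp t) * (g j + g (t - j)) := by
  obtain ⟨C, hC, hprod⟩ := exists_prod_one_sub_inv_le
  set κ : ℝ := (Real.log 2 / 2 ^ e) ^ 6 / 720 with hκ
  have hl2 : 0 < Real.log 2 := Real.log_pos one_lt_two
  have hκ0 : 0 < κ := by positivity
  have hgeo : Summable fun j : ℕ => 12 / κ * (1 / 4 : ℝ) ^ j :=
    (summable_geometric_of_lt_one (by norm_num) (by norm_num)).mul_left _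
  have hexp : Summable fun j : ℕ => 2 ^ J * C * Real.exp (-(1 / 8 : ℝ)) ^ j :=
    (summable_geometric_of_lt_one (Real.exp_pos _).le (Real.exp_lt_one_iff.2 (by norm_num))).mul_left _
  refine ⟨_, hgeo.add hexp, fun t j hj hjt => ?_⟩
  set T := min j (t - j) with hT
  set S := (Finset.Ioc (dexp j) (dexp (j + T))).filter (fun p => p.Prime ∧ Hits e j p) with hS
  have hjT : j + T ≤ t := by omega
  have hjT2 : j + T ≤ 2 * j := by omega
  have hSM : S ⊆ (dexp t).primesLE := by
    intro p hp
    obtain ⟨h1, h2⟩ := Finset.mem_filter.1 hp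
    exact Nat.mem_primesLE.2 ⟨(Finset.mem_Ioc.1 h1).2.trans (dexp_mono hjT), h2.1⟩
  have hSz : S ⊆ Finset.Icc 2 (dexp (j + T)) := by
    intro p hp
    obtain ⟨h1, h2⟩ := Finset.mem_filter.1 hp
    exact Finset.mem_Icc.2 ⟨h2.1.two_le, (Finset.mem_Ioc.1 h1).2⟩
  have hlM := log_dexp_pos t
  have ha := sum_few_prime_factors_le hSM J
  have hb := sum_exists_mul_dvd_le (M := dexp t) (y := dexp (j - e)) (Y := dexp j) hSz (dexp_pos _)
  set Fa := (Finset.Icc 1 (dexp t)).filter (fun m => ∑ p ∈ S, m.factorization p < J)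
  set Fb := (Finset.Icc 1 (dexp t)).filter (fun m => ∃ x ∈ Finset.Ioc (dexp (j - e)) (dexp j) ×ˢ
    S ×ˢ S, x.1 ∣ x.2.1 - 1 ∧ x.1 ∣ x.2.2 - 1 ∧ x.2.1 * x.2.2 ∣ m)
  have hcover : (Finset.Icc 1 (dexp t)).filter (fun m => ¬ GoodAt e J j m) ⊆ Fa ∪ Fb := by
    intro m hm
    obtain ⟨hm1, hm2⟩ := Finset.mem_filter.1 hm
    rw [Finset.mem_union]
    by_contra hc
    push Not at hc
    obtain ⟨hc1, hc2⟩ := hc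
    refine hm2 (goodAt_of_forall_not_dvd (S := S) ?_ ?_ ?_ ?_)
    · have := (Finset.mem_Icc.1 hm1).1
      omega
    · exact fun p hp => (Finset.mem_filter.1 hp).2
    · by_contra hlt
      exact hc1 (Finset.mem_filter.2 ⟨hm1, not_le.1 hlt⟩)
    · intro r hr p hp p' hp' h1 h2 h3
      exact hc2 (Finset.mem_filter.2 ⟨hm1, (r, p, p'), by
        simp only [Finset.mem_product]; exact ⟨hr, hp, hp'⟩, h1, h2, h3⟩)
  have h1 : ∑ m ∈ (Finset.Icc 1 (dexp t)).filter (fun m => ¬ GoodAt e J j m), 1 / (m : ℝ)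
      ≤ ∑ m ∈ Fa, 1 / (m : ℝ) + ∑ m ∈ Fb, 1 / (m : ℝ) := by
    refine (Finset.sum_le_sum_of_subset_of_nonneg hcover fun _ _ _ => by positivity).trans ?_
    rw [← Finset.sum_union_inter]
    exact le_add_of_nonneg_right (Finset.sum_nonneg fun _ _ => by positivity)
  have hH : ∑ m ∈ Finset.Icc 1 (dexp t), 1 / (m : ℝ) ≤ 3 * Real.log (dexp t) := by
    refine (sum_one_div_le_one_add_log _).trans ?_
    have h2 : Real.log 2 ≤ Real.log (dexp t) :=
      Real.log_le_log two_pos (by exact_mod_cast two_le_dexp t)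
    linarith [Real.log_two_gt_d9]
  have hb1 : (1 + Real.log (dexp (j + T))) ^ 2 / dexp (j - e) ≤ 4 / κ * (1 / 4) ^ j := by
    have h2 : 1 + Real.log (dexp (j + T)) ≤ 2 * 4 ^ j := by
      have h3 : Real.log (dexp (j + T)) ≤ 4 ^ j := by
        rw [log_dexp]
        calc (2 : ℝ) ^ (j + T) * Real.log 2 ≤ 2 ^ (2 * j) * 1 :=
              mul_le_mul (pow_le_pow_right₀ one_le_two hjT2)
                (by linarith [Real.log_two_lt_d9]) hl2.le (by positivity)
          _ = 4 ^ j := by rw [mul_one, pow_mul]; norm_num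
      have h4 : (1 : ℝ) ≤ 4 ^ j := one_le_pow₀ (by norm_num)
      linarith
    have h5 := dexp_sub_ge (e := e) (j := j) (by omega)
    rw [← hκ] at h5
    have hlz := log_dexp_pos (j + T)
    calc _ ≤ (2 * 4 ^ j) ^ 2 / (κ * (4 : ℝ) ^ (3 * j)) := by gcongr
      _ = _ := by
        rw [one_div, inv_pow, mul_comm 3 j, pow_mul]
        field_simp
        ring
  have hb2 : ∑ m ∈ Fb, 1 / (m : ℝ) ≤ Real.log (dexp t) * (12 / κ * (1 / 4) ^ j) := by
    calc _ ≤ _ := hb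
      _ ≤ 4 / κ * (1 / 4) ^ j * (3 * Real.log (dexp t)) :=
          mul_le_mul hb1 hH (Finset.sum_nonneg fun _ _ => by positivity) (by positivity)
      _ = _ := by ring
  have hST := sum_hits_windows_ge hB hj T
  rw [← hS] at hST
  have hexpT : Real.exp (-(∑ p ∈ S, 1 / (p : ℝ)) / 2)
      ≤ Real.exp (-(1 / 8 : ℝ)) ^ j + Real.exp (-(1 / 8 : ℝ)) ^ (t - j) := by
    have h2 : Real.exp (-(∑ p ∈ S, 1 / (p : ℝ)) / 2) ≤ Real.exp (-(1 / 8 : ℝ)) ^ T := by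
      rw [← Real.exp_nat_mul]
      refine Real.exp_le_exp.2 ?_
      linarith
    have h3 : ∀ n : ℕ, 0 ≤ Real.exp (-(1 / 8 : ℝ)) ^ n := fun n => pow_nonneg (Real.exp_pos _).le n
    rcases min_choice j (t - j) with h | h
    · rw [hT, h] at h2
      linarith [h3 (t - j)]
    · rw [hT, h] at h2
      linarith [h3 j]
  have ha2 : ∑ m ∈ Fa, 1 / (m : ℝ) ≤ Real.log (dexp t) *
      (2 ^ J * C * Real.exp (-(1 / 8 : ℝ)) ^ j
        + 2 ^ J * C * Real.exp (-(1 / 8 : ℝ)) ^ (t - j)) := by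
    calc _ ≤ _ := ha
      _ ≤ 2 ^ J * ((C * Real.log (dexp t)) *
          (Real.exp (-(1 / 8 : ℝ)) ^ j + Real.exp (-(1 / 8 : ℝ)) ^ (t - j))) := by
          refine mul_le_mul_of_nonneg_left ?_ (by positivity)
          exact mul_le_mul (hprod _ (two_le_dexp t)) hexpT (Real.exp_pos _).le (by positivity)
      _ = _ := by ring
  have h6 : 0 ≤ Real.log (dexp t) * (12 / κ * (1 / 4) ^ (t - j)) := by positivity
  calc _ ≤ _ := h1
    _ ≤ _ := add_le_add ha2 hb2
    _ ≤ _ := by linarith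

/-- Most integers `m` are good at all but boundedly many scales. -/
theorem exists_sum_forall_goodAt_ge {e i₀ : ℕ} (hei : e + 1 ≤ i₀)
    (hB : ∀ i j, i₀ ≤ j → j ≤ i → 1 / 4 ≤
      ∑ p ∈ (Finset.Ioc (dexp i) (dexp (i + 1))).filter (fun p => p.Prime ∧ Hits e j p),
        1 / (p : ℝ)) (J : ℕ) :
    ∃ j₀ K : ℕ, i₀ ≤ j₀ ∧ ∀ t, Real.log (dexp t) / 2 ≤
      ∑ m ∈ (Finset.Icc 1 (dexp t)).filter
        (fun m => ∀ j, j₀ ≤ j → j + K ≤ t → GoodAt e J j m), 1 / (m : ℝ) := by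
  obtain ⟨g, hg, hbad⟩ := exists_sum_not_goodAt_le hei hB J
  obtain ⟨N, hN⟩ := exists_forall_sum_le_of_summable hg (ε := 1 / 4) (by norm_num)
  refine ⟨max i₀ N, N, le_max_left _ _, fun t => ?_⟩
  have hlM := log_dexp_pos t
  set X := (Finset.range (t + 1)).filter (fun j => max i₀ N ≤ j ∧ j + N ≤ t) with hX
  set F := (Finset.Icc 1 (dexp t)).filter
        (fun m => ∀ j, max i₀ N ≤ j → j + N ≤ t → GoodAt e J j m) with hF
  have h1 : ∑ m ∈ (Finset.Icc 1 (dexp t)).filter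
        (fun m => ¬ ∀ j, max i₀ N ≤ j → j + N ≤ t → GoodAt e J j m), 1 / (m : ℝ)
      ≤ ∑ j ∈ X, ∑ m ∈ (Finset.Icc 1 (dexp t)).filter (fun m => ¬ GoodAt e J j m), 1 / (m : ℝ) := by
    refine le_trans (Finset.sum_le_sum_of_subset_of_nonneg ?_ fun _ _ _ => by positivity)
      (sum_filter_exists_le (Finset.Icc 1 (dexp t)) X (fun j m => ¬ GoodAt e J j m)
        fun m _ => by positivity)
    intro m hm
    obtain ⟨hm1, hm2⟩ := Finset.mem_filter.1 hm
    push Not at hm2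
    obtain ⟨j, hj1, hj2, hj3⟩ := hm2
    refine Finset.mem_filter.2 ⟨hm1, j, Finset.mem_filter.2 ⟨?_, hj1, hj2⟩, hj3⟩
    rw [Finset.mem_range]
    omega
  have h2 : ∑ j ∈ X, ∑ m ∈ (Finset.Icc 1 (dexp t)).filter (fun m => ¬ GoodAt e J j m), 1 / (m : ℝ)
      ≤ Real.log (dexp t) / 2 := by
    calc _ ≤ ∑ j ∈ X, Real.log (dexp t) * (g j + g (t - j)) := by
          refine Finset.sum_le_sum fun j hj => ?_
          obtain ⟨_, h3, h4⟩ := Finset.mem_filter.1 hj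
          exact hbad t j ((le_max_left _ _).trans h3) (by omega)
      _ = Real.log (dexp t) * (∑ j ∈ X, g j + ∑ j ∈ X.image (t - ·), g j) := by
          rw [← Finset.mul_sum, Finset.sum_add_distrib, Finset.sum_image]
          intro a ha b hb hab
          have ha' := (Finset.mem_filter.1 ha).2
          have hb' := (Finset.mem_filter.1 hb).2
          simp only at hab
          omega
      _ ≤ Real.log (dexp t) * (1 / 4 + 1 / 4) := by
          refine mul_le_mul_of_nonneg_left (add_le_add (hN _ ?_) (hN _ ?_)) hlM.le
          · exact fun j hj => (le_max_right _ _).trans (Finset.mem_filter.1 hj).2.1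
          · intro i hi
            obtain ⟨j, hj, rfl⟩ := Finset.mem_image.1 hi
            have := (Finset.mem_filter.1 hj).2
            omega
      _ = _ := by ring
  have h3 := log_le_sum_one_div (dexp t)
  rw [← Finset.sum_filter_add_sum_filter_not _
    (fun m => ∀ j, max i₀ N ≤ j → j + N ≤ t → GoodAt e J j m)] at h3
  linarith

theorem sum_piFinset_prod_eq_pow {k : ℕ} (I : Finset ℕ) (g : ℕ → ℝ) :
    ∑ f ∈ Fintype.piFinset (fun _ : Fin k => I), ∏ i, g (f i) = (∑ p ∈ I, g p) ^ k := by
  rw [← Finset.prod_univ_sum (fun _ : Fin k => I) (fun _ p => g p), Finset.prod_const,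
    Finset.card_univ, Fintype.card_fin]

theorem sum_few_le {h : ℕ} {I : Finset ℕ} {P : ℕ → Prop}
    (hν : ∑ p ∈ I.filter (fun p => ¬ P p), 1 / (p : ℝ) ≤ (∑ p ∈ I, 1 / (p : ℝ)) / 16) :
    ∑ f ∈ (Fintype.piFinset (fun _ : Fin (2 * h) => I)).filter
        (fun f => (Finset.univ.filter fun i => P (f i)).card < h), ∏ i, 1 / (f i : ℝ)
      ≤ (∑ p ∈ I, 1 / (p : ℝ)) ^ (2 * h) / 4 ^ h := by
  have h1 : ∑ f ∈ (Fintype.piFinset (fun _ : Fin (2 * h) => I)).filter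
        (fun f => (Finset.univ.filter fun i => P (f i)).card < h), ∏ i, 1 / (f i : ℝ)
      ≤ ∑ f ∈ Fintype.piFinset (fun _ : Fin (2 * h) => I),
        (∏ i, (1 / (f i : ℝ) * if ¬ P (f i) then 16 else 1)) / 16 ^ h := by
    rw [Finset.sum_filter]
    refine Finset.sum_le_sum fun f _ => ?_
    rw [Finset.prod_mul_distrib, Finset.prod_ite, Finset.prod_const, Finset.prod_const_one, mul_one]
    have h0 : (0 : ℝ) ≤ ∏ i, 1 / (f i : ℝ) := Finset.prod_nonneg fun _ _ => by positivity
    split_ifs with hc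
    · rw [mul_div_assoc]
      refine le_mul_of_one_le_right h0 ?_
      rw [one_le_div (by positivity)]
      refine pow_le_pow_right₀ (by norm_num) ?_
      have h2 := Finset.card_filter_add_card_filter_not (s := Finset.univ)
        (fun i : Fin (2 * h) => P (f i))
      rw [Finset.card_univ, Fintype.card_fin] at h2
      omega
    · positivity
  refine h1.trans ?_
  rw [← Finset.sum_div, sum_piFinset_prod_eq_pow I (fun p => 1 / (p : ℝ) * if ¬ P p then 16 else 1)]
  set μ := ∑ p ∈ I, 1 / (p : ℝ) with hμ
  have hμ0 : 0 ≤ μ := Finset.sum_nonneg fun _ _ => by positivity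
  have h3 : ∑ p ∈ I, (1 / (p : ℝ) * if ¬ P p then 16 else 1) ≤ 2 * μ := by
    have h4 : ∑ p ∈ I, (1 / (p : ℝ) * if ¬ P p then 16 else 1)
        = μ + 15 * ∑ p ∈ I.filter (fun p => ¬ P p), 1 / (p : ℝ) := by
      rw [Finset.sum_filter, hμ, Finset.mul_sum, ← Finset.sum_add_distrib]
      refine Finset.sum_congr rfl fun p _ => ?_
      split_ifs <;> ring
    rw [h4]
    linarith
  have h5 : 0 ≤ ∑ p ∈ I, (1 / (p : ℝ) * if ¬ P p then 16 else 1) :=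
    Finset.sum_nonneg fun _ _ => by positivity
  calc _ ≤ (2 * μ) ^ (2 * h) / 16 ^ h := by gcongr
    _ = _ := by
      rw [mul_pow, pow_mul 2 2 h, show (16 : ℝ) = 4 * 4 by norm_num, mul_pow]
      norm_num
      field_simp

theorem sum_common_divisor_le {k y Y z : ℕ} {I : Finset ℕ} (hI : I ⊆ Finset.Icc 2 z) (hy : 1 ≤ y) :
    ∑ f ∈ (Fintype.piFinset (fun _ : Fin k => I)).filter
        (fun f => ∃ x ∈ (Finset.univ : Finset (Fin k)).offDiag ×ˢ Finset.Ioc y Y,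
          x.2 ∣ f x.1.1 - 1 ∧ x.2 ∣ f x.1.2 - 1), ∏ i, 1 / (f i : ℝ)
      ≤ k ^ 2 * (∑ p ∈ I, 1 / (p : ℝ)) ^ (k - 2) * ((1 + Real.log z) ^ 2 / y) := by
  set μ := ∑ p ∈ I, 1 / (p : ℝ) with hμ
  have hμ0 : 0 ≤ μ := Finset.sum_nonneg fun _ _ => by positivity
  refine (sum_filter_exists_le _ _ (fun (x : (Fin k × Fin k) × ℕ) (f : Fin k → ℕ) =>
    x.2 ∣ f x.1.1 - 1 ∧ x.2 ∣ f x.1.2 - 1)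
    fun f _ => Finset.prod_nonneg fun _ _ => by positivity).trans ?_
  have h1 : ∀ x ∈ (Finset.univ : Finset (Fin k)).offDiag ×ˢ Finset.Ioc y Y,
      ∑ f ∈ (Fintype.piFinset (fun _ : Fin k => I)).filter
        (fun f => x.2 ∣ f x.1.1 - 1 ∧ x.2 ∣ f x.1.2 - 1), ∏ i, 1 / (f i : ℝ)
      ≤ μ ^ (k - 2) * (∑ p ∈ I, (if x.2 ∣ p - 1 then 1 / (p : ℝ) else 0)) ^ 2 := by
    rintro ⟨⟨i, i'⟩, r⟩ hx
    have hii : i ≠ i' := (Finset.mem_offDiag.1 (Finset.mem_product.1 hx).1).2.2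
    simp only
    set σ := ∑ p ∈ I, (if r ∣ p - 1 then 1 / (p : ℝ) else 0) with hσ
    have h2 : ∏ l : Fin k, ∑ p ∈ I,
        (if l ∈ ({i, i'} : Finset (Fin k)) then (if r ∣ p - 1 then 1 / (p : ℝ) else 0)
          else 1 / (p : ℝ)) = μ ^ (k - 2) * σ ^ 2 := by
      have h3 : ∀ l : Fin k, ∑ p ∈ I,
        (if l ∈ ({i, i'} : Finset (Fin k)) then (if r ∣ p - 1 then 1 / (p : ℝ) else 0)
          else 1 / (p : ℝ)) = if l ∈ ({i, i'} : Finset (Fin k)) then σ else μ := fun l => by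
        split_ifs <;> rfl
      rw [Finset.prod_congr rfl fun l _ => h3 l, Finset.prod_ite, Finset.prod_const,
        Finset.prod_const, mul_comm]
      have h4 := Finset.card_filter_add_card_filter_not (s := Finset.univ)
        (fun l : Fin k => l ∈ ({i, i'} : Finset (Fin k)))
      have h5 : (Finset.univ.filter fun l : Fin k => l ∈ ({i, i'} : Finset (Fin k))).card = 2 := by
        rw [Finset.filter_mem_eq_inter, Finset.univ_inter, Finset.card_pair hii]
      rw [h5, Finset.card_univ, Fintype.card_fin] at h4
      rw [h5]
      congr 2
      omega
    rw [← h2, Finset.prod_univ_sum, Finset.sum_filter]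
    refine Finset.sum_le_sum fun f _ => ?_
    split_ifs with hc
    · refine (Finset.prod_congr rfl fun l _ => ?_).le
      split_ifs with hl hr
      · rfl
      · rw [Finset.mem_insert, Finset.mem_singleton] at hl
        rcases hl with rfl | rfl
        exacts [absurd hc.1 hr, absurd hc.2 hr]
      · rfl
    · exact Finset.prod_nonneg fun _ _ => by positivity
  refine (Finset.sum_le_sum h1).trans ?_
  rw [Finset.sum_product]
  refine (Finset.sum_le_card_nsmul _ _ (μ ^ (k - 2) * ((1 + Real.log z) ^ 2 / y))
    fun x _ => ?_).trans ?_
  · rw [← Finset.mul_sum]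
    refine mul_le_mul_of_nonneg_left ?_ (by positivity)
    convert sum_sq_congr_one_le (Y := Y) hI hy
  have h7 : (((Finset.univ : Finset (Fin k)).offDiag.card : ℕ) : ℝ) ≤ k ^ 2 := by
    rw [Finset.offDiag_card, Finset.card_univ, Fintype.card_fin]
    have : k * k - k ≤ k ^ 2 := by rw [sq]; exact Nat.sub_le _ _
    exact_mod_cast this
  rw [nsmul_eq_mul, mul_assoc]
  gcongr

theorem goodAt_prod {e h j k : ℕ} {f : Fin k → ℕ} (hf : ∀ i, (f i).Prime)
    (hh : h ≤ (Finset.univ.filter fun i => Hits e j (f i)).card)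
    (hne : ∀ i i', i ≠ i' → ∀ r ∈ Finset.Ioc (dexp (j - e)) (dexp j),
      r ∣ f i - 1 → ¬ r ∣ f i' - 1) : GoodAt e h j (∏ i, f i) := by
  have hch : ∀ i ∈ Finset.univ.filter (fun i => Hits e j (f i)), ∃ r, r.Prime ∧
      dexp (j - e) < r ∧ r ≤ dexp j ∧ r ∣ f i - 1 := fun i hi => (Finset.mem_filter.1 hi).2
  choose! g hg1 hg2 hg3 hg4 using hch
  refine ⟨(Finset.univ.filter fun i => Hits e j (f i)).image g, ?_, ?_⟩
  · rw [Finset.card_image_of_injOn]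
    · exact hh
    · intro i hi i' hi' hii
      by_contra hc
      refine hne i i' hc (g i) (Finset.mem_Ioc.2 ⟨hg2 i hi, hg3 i hi⟩) (hg4 i hi) ?_
      rw [hii]
      exact hg4 i' hi'
  · intro r hr
    obtain ⟨i, hi, rfl⟩ := Finset.mem_image.1 hr
    exact ⟨hg1 i hi, hg2 i hi, hg3 i hi, f i, hf i, Finset.dvd_prod_of_mem f (Finset.mem_univ i),
      hg4 i hi⟩

theorem sum_not_goodAt_prod_le {e h j z : ℕ} {I : Finset ℕ} (hI : I ⊆ Finset.Icc 2 z)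
    (hp : ∀ p ∈ I, p.Prime)
    (hν : ∑ p ∈ I.filter (fun p => ¬ Hits e j p), 1 / (p : ℝ) ≤ (∑ p ∈ I, 1 / (p : ℝ)) / 16) :
    ∑ f ∈ (Fintype.piFinset (fun _ : Fin (2 * h) => I)).filter
        (fun f => ¬ GoodAt e h j (∏ i, f i)), ∏ i, 1 / (f i : ℝ)
      ≤ (∑ p ∈ I, 1 / (p : ℝ)) ^ (2 * h) / 4 ^ h
        + (2 * h : ℕ) ^ 2 * (∑ p ∈ I, 1 / (p : ℝ)) ^ (2 * h - 2) *
          ((1 + Real.log z) ^ 2 / dexp (j - e)) := by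
  have h1 := sum_few_le (h := h) hν
  have h2 := sum_common_divisor_le (k := 2 * h) (Y := dexp j) hI (dexp_pos (j - e))
  refine le_trans ?_ (add_le_add h1 h2)
  rw [← Finset.sum_union_inter]
  have h0 : ∀ f : Fin (2 * h) → ℕ, 0 ≤ ∏ i, 1 / (f i : ℝ) :=
    fun f => Finset.prod_nonneg fun _ _ => by positivity
  refine le_add_of_le_of_nonneg (Finset.sum_le_sum_of_subset_of_nonneg ?_ fun _ _ _ => h0 _)
    (Finset.sum_nonneg fun _ _ => h0 _)
  intro f hf
  obtain ⟨hf1, hf2⟩ := Finset.mem_filter.1 hf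
  rw [Finset.mem_union]
  by_contra hc
  push Not at hc
  obtain ⟨hc1, hc2⟩ := hc
  refine hf2 (goodAt_prod (fun i => hp _ (Fintype.mem_piFinset.1 hf1 i)) ?_ ?_)
  · by_contra hlt
    exact hc1 (Finset.mem_filter.2 ⟨hf1, not_le.1 hlt⟩)
  · intro i i' hii r hr h3 h4
    refine hc2 (Finset.mem_filter.2 ⟨hf1, ((i, i'), r), ?_, h3, h4⟩)
    simp only [Finset.mem_product, Finset.mem_offDiag, Finset.mem_univ, true_and]
    exact ⟨hii, hr⟩

/-- Most tuples of primes from `(u ^ a, u ^ (a + 1)]` are good at the top scales. -/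
theorem exists_sum_forall_goodAt_prod_ge (e i₀ K a : ℕ) {h : ℕ} (ha : 1 ≤ a) (hh : 1 ≤ h)
    (hK : (K : ℝ) / 4 ^ h ≤ 1 / 4) :
    ∃ t₀ : ℕ, ∀ t u : ℕ, t₀ ≤ t → dexp t ≤ u ^ a → u ^ a < dexp (t + 2) → ∀ I : Finset ℕ,
      I = (Finset.Ioc (u ^ a) (u ^ (a + 1))).filter Nat.Prime →
      1 / (2 * (a + 1 : ℝ)) ≤ ∑ p ∈ I, 1 / (p : ℝ) →
      (∀ j, i₀ ≤ j → dexp j ≤ u ^ a →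
        ∑ p ∈ I.filter (fun p => ¬ Hits e j p), 1 / (p : ℝ) ≤ (∑ p ∈ I, 1 / (p : ℝ)) / 16) →
      (∑ p ∈ I, 1 / (p : ℝ)) ^ (2 * h) / 2 ≤
        ∑ f ∈ (Fintype.piFinset (fun _ : Fin (2 * h) => I)).filter
          (fun f => ∀ j, j ≤ t → t < j + K → GoodAt e h j (∏ i, f i)), ∏ i, 1 / (f i : ℝ) := by
  set κ : ℝ := (Real.log 2 / 2 ^ (K + e)) ^ 6 / 720 with hκ
  have hl2 : 0 < Real.log 2 := Real.log_pos one_lt_two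
  have hκ0 : 0 < κ := by positivity
  set c : ℝ := K * (2 * h : ℕ) ^ 2 * (2 * (a + 1)) ^ 2 * (25 * (a + 1) ^ 2) / κ with hc
  have hc0 : 0 ≤ c := by positivity
  have htend : Tendsto (fun t : ℕ => c * (1 / 16 : ℝ) ^ t) atTop (nhds 0) := by
    simpa using (tendsto_pow_atTop_nhds_zero_of_lt_one (by norm_num : (0 : ℝ) ≤ 1 / 16)
      (by norm_num)).const_mul c
  obtain ⟨t₁, ht₁⟩ := eventually_atTop.1
    (htend.eventually (ge_mem_nhds (show (0 : ℝ) < 1 / 4 by norm_num)))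
  refine ⟨max t₁ (i₀ + K + e), fun t u ht hdu hud I hI hμ hν => ?_⟩
  have ht1 := ht₁ t ((le_max_left _ _).trans ht)
  have ht2 : i₀ + K + e ≤ t := (le_max_right _ _).trans ht
  set μ := ∑ p ∈ I, 1 / (p : ℝ) with hμdef
  have hμ0 : 0 < μ := lt_of_lt_of_le (by positivity) hμ
  have hu1 : 1 ≤ u := by
    by_contra hc
    have h1 : u = 0 := by omega
    rw [h1, zero_pow (by omega)] at hdu
    have := dexp_pos t
    omega
  have hIz : I ⊆ Finset.Icc 2 (u ^ (a + 1)) := by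
    intro p hp
    rw [hI] at hp
    obtain ⟨h1, h2⟩ := Finset.mem_filter.1 hp
    exact Finset.mem_Icc.2 ⟨h2.two_le, (Finset.mem_Ioc.1 h1).2⟩
  have hIp : ∀ p ∈ I, p.Prime := fun p hp => by
    rw [hI] at hp
    exact (Finset.mem_filter.1 hp).2
  have hlog : 1 + Real.log (u ^ (a + 1) : ℕ) ≤ 5 * (a + 1) * 2 ^ t := by
    have h1 : Real.log (u ^ a : ℕ) ≤ Real.log (dexp (t + 2)) :=
      Real.log_le_log (by exact_mod_cast Nat.pos_of_ne_zero (by positivity)) (by exact_mod_cast hud.le)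
    rw [log_dexp, Nat.cast_pow, Real.log_pow, pow_add] at h1
    have h2 : 0 ≤ Real.log u := Real.log_natCast_nonneg u
    have h3 : (1 : ℝ) ≤ a := by exact_mod_cast ha
    have h4 : Real.log u ≤ a * Real.log u := le_mul_of_one_le_left h2 h3
    have h5 : (2 : ℝ) ^ t * 2 ^ 2 * Real.log 2 ≤ 2 ^ t * 2 ^ 2 * 1 := by
      have := Real.log_two_lt_d9
      gcongr
      linarith
    have h6 : Real.log u ≤ 4 * 2 ^ t := by linarith
    have h7 : (1 : ℝ) ≤ 2 ^ t := one_le_pow₀ one_le_two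
    rw [Nat.cast_pow, Real.log_pow]
    push_cast
    have h8 : (a + 1 : ℝ) * Real.log u ≤ (a + 1) * (4 * 2 ^ t) := by gcongr
    have h9 : 0 ≤ (a : ℝ) * 2 ^ t := by positivity
    linarith
  have hlog0 : 0 ≤ 1 + Real.log (u ^ (a + 1) : ℕ) := by
    have := Real.log_natCast_nonneg (u ^ (a + 1))
    linarith
  set X := (Finset.range (t + 1)).filter (fun j => t < j + K) with hX
  have hXcard : (X.card : ℝ) ≤ K := by
    have h1 : X ⊆ Finset.Ioc (t - K) t := by
      intro j hj
      obtain ⟨h1, h2⟩ := Finset.mem_filter.1 hj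
      rw [Finset.mem_range] at h1
      rw [Finset.mem_Ioc]
      omega
    have h2 := Finset.card_le_card h1
    rw [Nat.card_Ioc] at h2
    exact_mod_cast (by omega : X.card ≤ K)
  have hbad : ∀ j ∈ X, ∑ f ∈ (Fintype.piFinset (fun _ : Fin (2 * h) => I)).filter
        (fun f => ¬ GoodAt e h j (∏ i, f i)), ∏ i, 1 / (f i : ℝ)
      ≤ μ ^ (2 * h) / 4 ^ h + (2 * h : ℕ) ^ 2 * μ ^ (2 * h - 2) *
          ((5 * (a + 1) * 2 ^ t) ^ 2 / (κ * 4 ^ (3 * t))) := by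
    intro j hj
    obtain ⟨hj1, hj2⟩ := Finset.mem_filter.1 hj
    rw [Finset.mem_range] at hj1
    refine (sum_not_goodAt_prod_le hIz hIp
      (hν j (by omega) ((dexp_mono (by omega)).trans hdu))).trans ?_
    have h1 : κ * 4 ^ (3 * t) ≤ dexp (j - e) := by
      refine (dexp_sub_ge (e := K + e) (j := t) (by omega)).trans ?_
      exact_mod_cast dexp_mono (by omega : t - (K + e) ≤ j - e)
    gcongr
  have hμ2 : μ ^ (2 * h - 2) ≤ μ ^ (2 * h) * (2 * (a + 1)) ^ 2 := by
    have h1 : μ ^ (2 * h) = μ ^ (2 * h - 2) * μ ^ 2 := by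
      rw [← pow_add]; congr 1; omega
    have h2 : 1 ≤ μ * (2 * (a + 1)) := by
      rwa [div_le_iff₀ (by positivity)] at hμ
    have h3 : 1 ≤ (μ * (2 * (a + 1))) ^ 2 := one_le_pow₀ h2
    rw [h1, mul_assoc, ← mul_pow]
    exact le_mul_of_one_le_right (by positivity) h3
  have htotal : ∑ j ∈ X, ∑ f ∈ (Fintype.piFinset (fun _ : Fin (2 * h) => I)).filter
        (fun f => ¬ GoodAt e h j (∏ i, f i)), ∏ i, 1 / (f i : ℝ) ≤ μ ^ (2 * h) / 2 := by
    calc _ ≤ _ := Finset.sum_le_sum hbad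
      _ = X.card * (μ ^ (2 * h) / 4 ^ h + (2 * h : ℕ) ^ 2 * μ ^ (2 * h - 2) *
          ((5 * (a + 1) * 2 ^ t) ^ 2 / (κ * 4 ^ (3 * t)))) := by
          rw [Finset.sum_const, nsmul_eq_mul]
      _ ≤ K * (μ ^ (2 * h) / 4 ^ h + (2 * h : ℕ) ^ 2 * (μ ^ (2 * h) * (2 * (a + 1)) ^ 2) *
          ((5 * (a + 1) * 2 ^ t) ^ 2 / (κ * 4 ^ (3 * t)))) := by gcongr
      _ = μ ^ (2 * h) * (K / 4 ^ h + c * (1 / 16) ^ t) := by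
          have h1 : ((5 : ℝ) * (a + 1) * 2 ^ t) ^ 2 / (κ * 4 ^ (3 * t))
              = 25 * (a + 1) ^ 2 / κ * (1 / 16) ^ t := by
            have h2 : (4 : ℝ) ^ (3 * t) = (2 ^ t) ^ 2 * 16 ^ t := by
              rw [← pow_mul, mul_comm t 2, pow_mul 2 2 t, pow_mul, ← mul_pow]
              norm_num
            rw [h2, one_div, inv_pow]
            field_simp
            ring
          rw [h1, hc]
          ring
      _ ≤ μ ^ (2 * h) * (1 / 4 + 1 / 4) := by gcongr
      _ = _ := by ring
  have h1 : ∑ f ∈ (Fintype.piFinset (fun _ : Fin (2 * h) => I)).filter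
        (fun f => ¬ ∀ j, j ≤ t → t < j + K → GoodAt e h j (∏ i, f i)), ∏ i, 1 / (f i : ℝ)
      ≤ ∑ j ∈ X, ∑ f ∈ (Fintype.piFinset (fun _ : Fin (2 * h) => I)).filter
        (fun f => ¬ GoodAt e h j (∏ i, f i)), ∏ i, 1 / (f i : ℝ) := by
    have h0 : ∀ f : Fin (2 * h) → ℕ, 0 ≤ ∏ i, 1 / (f i : ℝ) :=
      fun f => Finset.prod_nonneg fun _ _ => by positivity
    refine le_trans (Finset.sum_le_sum_of_subset_of_nonneg ?_ fun _ _ _ => h0 _)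
      (sum_filter_exists_le _ X (fun j (f : Fin (2 * h) → ℕ) => ¬ GoodAt e h j (∏ i, f i))
        fun f _ => h0 f)
    intro f hf
    obtain ⟨hf1, hf2⟩ := Finset.mem_filter.1 hf
    push Not at hf2
    obtain ⟨j, hj1, hj2, hj3⟩ := hf2
    exact Finset.mem_filter.2 ⟨hf1, j, Finset.mem_filter.2
      ⟨Finset.mem_range.2 (by omega), hj2⟩, hj3⟩
  have h2 := sum_piFinset_prod_eq_pow (k := 2 * h) I (fun p => 1 / (p : ℝ))
  rw [← Finset.sum_filter_add_sum_filter_not _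
    (fun f => ∀ j, j ≤ t → t < j + K → GoodAt e h j (∏ i, f i))] at h2
  linarith

theorem exists_primeCounting_ge :
    ∃ c : ℝ, 0 < c ∧ ∀ᶠ n : ℕ in atTop, c * n / Real.log n ≤ n.primeCounting := by
  have hl2 : 0 < Real.log 2 := Real.log_pos one_lt_two
  refine ⟨Real.log 2 / 2, by positivity, ?_⟩
  have h1 : ∀ᶠ n : ℕ in atTop, Real.log (n : ℝ) ≤ Real.log 2 / 4 * n := by
    have := (Real.isLittleO_log_id_atTop.comp_tendsto tendsto_natCast_atTop_atTop).bound
      (show 0 < Real.log 2 / 4 by positivity)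
    filter_upwards [this] with n hn
    simpa using (le_abs_self _).trans hn
  filter_upwards [h1, eventually_ge_atTop 4] with n hn hn4
  have hn0 : (4 : ℝ) ≤ n := by exact_mod_cast hn4
  have h2 : Real.log (n + 1 : ℝ) ≤ Real.log 2 / 2 * n := by
    have h3 : Real.log (n + 1 : ℝ) ≤ Real.log 2 + Real.log n := by
      rw [← Real.log_mul (by norm_num) (by linarith)]
      exact Real.log_le_log (by linarith) (by linarith)
    nlinarith
  refine le_trans ?_ (Chebyshev.pi_ge n)
  have : 0 < Real.log n := Real.log_pos (by linarith)
  gcongr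
  linarith

theorem exists_card_prime_Ioc_ge (s b : ℕ) :
    ∃ c : ℝ, 0 < c ∧ ∀ᶠ u : ℕ in atTop, ∀ Y, u ^ (s + 1) ≤ Y → Y ≤ u ^ b →
      c * Y / Real.log u ≤ (((Finset.Ioc (u ^ s) Y).filter Nat.Prime).card : ℝ) := by
  obtain ⟨c, hc, h⟩ := exists_primeCounting_ge
  obtain ⟨N, hN⟩ := eventually_atTop.1 h
  refine ⟨c / (2 * (b + 1)), by positivity, ?_⟩
  have h1 : ∀ᶠ u : ℕ in atTop, Real.log (u : ℝ) ≤ c / (2 * (b + 1)) * u := by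
    have := (Real.isLittleO_log_id_atTop.comp_tendsto tendsto_natCast_atTop_atTop).bound
      (show 0 < c / (2 * (b + 1)) by positivity)
    filter_upwards [this] with n hn
    simpa using (le_abs_self _).trans hn
  filter_upwards [h1, eventually_ge_atTop 2, eventually_ge_atTop N] with u hu hu2 huN Y hY hYb
  have hu0 : (2 : ℝ) ≤ u := by exact_mod_cast hu2
  have hl : 0 < Real.log u := Real.log_pos (by linarith)
  have huY : u ≤ Y := (Nat.le_self_pow (by omega) u).trans hY
  have hY2 : (2 : ℝ) ≤ Y := by exact_mod_cast hu2.trans huY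
  have hlY : 0 < Real.log Y := Real.log_pos (by linarith)
  have h2 : Real.log Y ≤ (b + 1) * Real.log u := by
    have h3 : Real.log Y ≤ Real.log ((u : ℝ) ^ b) :=
      Real.log_le_log (by linarith) (by exact_mod_cast hYb)
    rw [Real.log_pow] at h3
    linarith
  have h3 : c * Y / ((b + 1) * Real.log u) ≤ Y.primeCounting :=
    le_trans (by gcongr) (hN Y (huN.trans huY))
  have h4 : Y.primeCounting ≤ u ^ s + ((Finset.Ioc (u ^ s) Y).filter Nat.Prime).card := by
    have h5 : ((Finset.range (Y + 1)).filter Nat.Prime) ⊆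
        Finset.Icc 1 (u ^ s) ∪ (Finset.Ioc (u ^ s) Y).filter Nat.Prime := by
      intro p hp
      simp only [Finset.mem_filter, Finset.mem_range, Finset.mem_union, Finset.mem_Icc,
        Finset.mem_Ioc] at hp ⊢
      have := hp.2.one_lt
      by_cases hps : p ≤ u ^ s
      · left; omega
      · right; exact ⟨⟨by omega, by omega⟩, hp.2⟩
    have h6 := (Finset.card_le_card h5).trans (Finset.card_union_le _ _)
    rw [Nat.card_Icc, Nat.add_sub_cancel] at h6
    rw [Nat.primeCounting, Nat.primeCounting', Nat.count_eq_card_filter_range]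
    convert h6
  have h5 : (Y.primeCounting : ℝ) ≤ (u : ℝ) ^ s +
      ((Finset.Ioc (u ^ s) Y).filter Nat.Prime).card := by exact_mod_cast h4
  have h6 : (u : ℝ) ^ s * u ≤ Y := by
    rw [← pow_succ]; exact_mod_cast hY
  have h7 : (u : ℝ) ^ s ≤ c / (2 * (b + 1)) * Y / Real.log u := by
    rw [le_div_iff₀ hl]
    calc (u : ℝ) ^ s * Real.log u ≤ (u : ℝ) ^ s * (c / (2 * (b + 1)) * u) := by gcongr
      _ = c / (2 * (b + 1)) * ((u : ℝ) ^ s * u) := by ring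
      _ ≤ _ := by gcongr
  have h8 : c * Y / ((b + 1) * Real.log u) =
      c / (2 * (b + 1)) * Y / Real.log u + c / (2 * (b + 1)) * Y / Real.log u := by
    field_simp
    ring
  linarith

/-- The representation of an integer as `p₀ * m * ∏ f i * P` is unique up to at most `k ^ k`
choices. -/
theorem card_le_mul_card_image_mul_prod {k p₀ M W U : ℕ} {S : Finset ((_ : ℕ × (Fin k → ℕ)) × ℕ)}
    (h : ∀ s ∈ S, 1 ≤ s.1.1 ∧ s.1.1 ≤ M ∧ (∀ i, (s.1.2 i).Prime ∧ W < s.1.2 i ∧ s.1.2 i ≤ U) ∧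
      s.2.Prime ∧ U < s.2) (hp₀ : 1 ≤ p₀) (hpW : p₀ ≤ W) (hMW : M ≤ W) (hWU : W ≤ U) :
    S.card ≤ k ^ k * (S.image fun s => p₀ * s.1.1 * (∏ i, s.1.2 i) * s.2).card := by
  refine Finset.card_le_mul_card_image S _ fun n hn => ?_
  obtain ⟨s₀, hs₀, rfl⟩ := Finset.mem_image.1 hn
  obtain ⟨h1, h2, h3, h4, h5⟩ := h s₀ hs₀
  calc _ ≤ (Fintype.piFinset fun _ : Fin k => Finset.univ.image s₀.1.2).card := ?_
    _ = (Finset.univ.image s₀.1.2).card ^ k := by simp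
    _ ≤ k ^ k := Nat.pow_le_pow_left (Finset.card_image_le.trans (by simp)) k
  refine Finset.card_le_card_of_injOn (fun s => s.1.2) ?_ ?_
  · intro s hs
    rw [Finset.mem_coe, Finset.mem_filter] at hs
    obtain ⟨hs, he⟩ := hs
    obtain ⟨g1, g2, g3, g4, g5⟩ := h s hs
    rw [Finset.mem_coe, Fintype.mem_piFinset]
    intro i
    obtain ⟨gp, gW, gU⟩ := g3 i
    have hd : s.1.2 i ∣ p₀ * s₀.1.1 * (∏ i, s₀.1.2 i) * s₀.2 := by
      rw [← he]
      exact Dvd.dvd.mul_right (Dvd.dvd.mul_left (Finset.dvd_prod_of_mem _ (Finset.mem_univ i)) _) _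
    rcases gp.dvd_mul.1 hd with hd | hd
    · rcases gp.dvd_mul.1 hd with hd | hd
      · rcases gp.dvd_mul.1 hd with hd | hd
        · have := Nat.le_of_dvd (by omega) hd
          omega
        · have := Nat.le_of_dvd (by omega) hd
          omega
      · obtain ⟨l, hl, hd⟩ := (Prime.dvd_finsetProd_iff gp.prime _).1 hd
        exact Finset.mem_image.2 ⟨l, hl, ((Nat.prime_dvd_prime_iff_eq gp (h3 l).1).1 hd).symm⟩
    · have := (Nat.prime_dvd_prime_iff_eq gp h4).1 hd
      omega
  · intro s hs s' hs' hf
    rw [Finset.mem_coe, Finset.mem_filter] at hs hs'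
    obtain ⟨hs, he⟩ := hs
    obtain ⟨hs', he'⟩ := hs'
    obtain ⟨g1, g2, g3, g4, g5⟩ := h s hs
    obtain ⟨g1', g2', g3', g4', g5'⟩ := h s' hs'
    obtain ⟨⟨m, f⟩, P⟩ := s
    obtain ⟨⟨m', f'⟩, P'⟩ := s'
    simp only at *
    subst hf
    have hpos : 0 < p₀ * ∏ i, f i :=
      Nat.mul_pos hp₀ (Finset.prod_pos fun i _ => (g3 i).1.pos)
    have hmP : m * P = m' * P' := by
      refine Nat.eq_of_mul_eq_mul_left hpos ?_
      calc _ = p₀ * m * (∏ i, f i) * P := by ring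
        _ = p₀ * m' * (∏ i, f i) * P' := he.trans he'.symm
        _ = _ := by ring
    have hPP : P = P' := by
      have hd : P ∣ m' * P' := hmP ▸ dvd_mul_left P m
      rcases g4.dvd_mul.1 hd with hd | hd
      · have := Nat.le_of_dvd (by omega) hd
        omega
      · exact (Nat.prime_dvd_prime_iff_eq g4 g4').1 hd
    subst hPP
    rw [Nat.eq_of_mul_eq_mul_right g4.pos hmP]

theorem exists_dexp_le_lt {s N : ℕ} (h : dexp s ≤ N) :
    ∃ t, s ≤ t ∧ dexp t ≤ N ∧ N < dexp (t + 1) := by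
  have hex : ∃ t, N < dexp (t + 1) :=
    ((tendsto_dexp.comp (tendsto_add_atTop_nat 1)).eventually (eventually_gt_atTop N)).exists
  refine ⟨max s (Nat.find hex), le_max_left _ _, ?_, ?_⟩
  · rcases le_total (Nat.find hex) s with hle | hle
    · rwa [max_eq_left hle]
    · rw [max_eq_right hle]
      rcases Nat.eq_zero_or_pos (Nat.find hex) with h0 | h0
      · rw [h0]
        exact (dexp_mono (Nat.zero_le s)).trans h
      · have := Nat.find_min hex (Nat.sub_lt h0 one_pos)
        rw [show Nat.find hex - 1 + 1 = Nat.find hex by omega] at this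
        omega
  · exact (Nat.find_spec hex).trans_le (dexp_mono (by have := le_max_right s (Nat.find hex); omega))

theorem GoodAt.exists_le_prod {e J j n : ℕ} (h : GoodAt e J j n) :
    ∃ T : Finset ℕ, (∀ r ∈ T, r.Prime ∧ r ≤ dexp j ∧ ∃ p, p.Prime ∧ p ∣ n ∧ r ∣ p - 1) ∧
      dexp (j - e) ^ J ≤ ∏ r ∈ T, r := by
  obtain ⟨T, hJ, hT⟩ := h
  refine ⟨T, fun r hr => ⟨(hT r hr).1, (hT r hr).2.2⟩, ?_⟩
  calc dexp (j - e) ^ J ≤ dexp (j - e) ^ T.card := Nat.pow_le_pow_right (dexp_pos _) hJ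
    _ ≤ ∏ r ∈ T, r := Finset.pow_card_le_prod _ _ _ fun r hr => (hT r hr).2.1.le

theorem uDense_carmichael_of_goodAt {n B p₀ e j₀ t h : ℕ} (hn : n ≠ 0)
    (hB : ∀ p, p.Prime → p ∣ n → p ≤ B) (hp₀ : p₀.Prime) (hp₀n : p₀ ∣ n)
    (hv : dexp j₀ ∣ p₀ - 1) (hej : e ≤ j₀)
    (hg : ∀ j, j₀ ≤ j → j < t → GoodAt e (2 ^ (e + 1)) j n) (hgt : GoodAt e h t n)
    (hBt : B ≤ dexp (t - e) ^ h) : UDense (carmichael n) 2 := by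
  refine uDense_carmichael hn hB hp₀ hp₀n hv fun q hq hqB => ?_
  by_cases hqt : q ≤ dexp t
  · obtain ⟨j, hj, hjq, hqj⟩ := exists_dexp_le_lt (s := j₀) (N := q - 1) (Nat.le_sub_one_of_lt hq)
    have hjt : j < t := by
      by_contra hc
      have := dexp_mono (not_lt.1 hc)
      have := dexp_pos j
      omega
    have := dexp_pos j
    obtain ⟨T, hT, hp⟩ := (hg j hj hjt).exists_le_prod
    refine ⟨T, fun r hr => ⟨(hT r hr).1, by have := (hT r hr).2.1; omega, (hT r hr).2.2⟩, ?_⟩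
    rw [← dexp_add, show j - e + (e + 1) = j + 1 by omega] at hp
    omega
  · obtain ⟨T, hT, hp⟩ := hgt.exists_le_prod
    exact ⟨T, fun r hr => ⟨(hT r hr).1, by have := (hT r hr).2.1; omega, (hT r hr).2.2⟩,
      (hqB.trans hBt).trans hp⟩

theorem eventually_exists_pow_le_le {E : ℕ} (hE : E ≠ 0) {P : ℕ → Prop}
    (hP : ∀ᶠ u in atTop, P u) :
    ∀ᶠ X : ℕ in atTop, ∃ u, P u ∧ u ^ E ≤ X ∧ X ≤ u ^ (E + 1) := by
  obtain ⟨N, hN⟩ := eventually_atTop.1 hP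
  filter_upwards [eventually_ge_atTop (max N (2 ^ E) ^ E)] with X hX
  obtain ⟨u, hu, hu'⟩ := exists_pow_le_lt hE X
  have h1 : max N (2 ^ E) ≤ u := Nat.lt_succ_iff.1 (lt_of_pow_lt_pow_left₀ E (by omega)
    (hX.trans_lt hu'))
  have h2 : 2 ^ E ≤ u := (le_max_right _ _).trans h1
  have h3 : 1 ≤ u := Nat.one_le_two_pow.trans h2
  refine ⟨u, hN u ((le_max_left _ _).trans h1), hu, hu'.le.trans ?_⟩
  calc (u + 1) ^ E ≤ (2 * u) ^ E := Nat.pow_le_pow_left (by omega) E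
    _ = 2 ^ E * u ^ E := mul_pow _ _ _
    _ ≤ u * u ^ E := Nat.mul_le_mul_right _ h2
    _ = u ^ (E + 1) := by ring

theorem pow_le_div_le_pow {X p₀ u a k m : ℕ} {f : Fin k → ℕ} (hp₀ : 1 ≤ p₀) (hp₀u : p₀ ≤ u)
    (hm : 1 ≤ m) (hmu : m ≤ u ^ a) (hf : ∀ i, u ^ a < f i ∧ f i ≤ u ^ (a + 1))
    (hX : u ^ ((a + 1) * k + 2 * a + 3) ≤ X) (hX' : X ≤ u ^ ((a + 1) * k + 2 * a + 4)) :
    0 < p₀ * m * ∏ i, f i ∧ u ^ (a + 2) ≤ X / (p₀ * m * ∏ i, f i) ∧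
      X / (p₀ * m * ∏ i, f i) ≤ u ^ (k + 2 * a + 4) := by
  have hu : 0 < u := hp₀.trans hp₀u
  have h1 : u ^ (a * k) ≤ ∏ i, f i := by
    calc u ^ (a * k) = ∏ _i : Fin k, u ^ a := by simp [pow_mul]
      _ ≤ _ := Finset.prod_le_prod' fun i _ => (hf i).1.le
  have h2 : ∏ i, f i ≤ u ^ ((a + 1) * k) := by
    calc _ ≤ ∏ _i : Fin k, u ^ (a + 1) := Finset.prod_le_prod' fun i _ => (hf i).2
      _ = _ := by simp [pow_mul]
  have hpos : 0 < p₀ * m * ∏ i, f i :=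
    Nat.mul_pos (Nat.mul_pos hp₀ hm) ((Nat.pow_pos hu).trans_le h1)
  refine ⟨hpos, ?_, ?_⟩
  · rw [Nat.le_div_iff_mul_le hpos]
    refine le_trans ?_ hX
    calc u ^ (a + 2) * (p₀ * m * ∏ i, f i) ≤ u ^ (a + 2) * (u * u ^ a * u ^ ((a + 1) * k)) := by
          gcongr
      _ = _ := by ring
  · refine Nat.div_le_of_le_mul (hX'.trans ?_)
    calc u ^ ((a + 1) * k + 2 * a + 4) = 1 * 1 * u ^ (a * k) * u ^ (k + 2 * a + 4) := by ring
      _ ≤ _ := by gcongr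

theorem half_div_le_natDiv {X d : ℕ} (hd : 0 < d) (h : 1 ≤ X / d) :
    (X : ℝ) / (2 * d) ≤ (X / d : ℕ) := by
  have h1 : X < (X / d + 1) * d := by
    have := Nat.lt_div_mul_add hd (a := X)
    linarith
  have h2 : (X : ℝ) < ((X / d : ℕ) + 1) * d := by exact_mod_cast h1
  have h3 : (1 : ℝ) ≤ (X / d : ℕ) := by exact_mod_cast h
  have h4 : (0 : ℝ) < d := by exact_mod_cast hd
  rw [div_le_iff₀ (by positivity)]
  nlinarith

/-- A lower bound for the number of integers up to `X` of the form `p₀ * m * ∏ f i * P` with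
`m ∈ G₁`, `f ∈ G₂` and `P` a large prime. -/
theorem exists_card_image_ge (p₀ a k : ℕ) (hp₀ : 1 ≤ p₀) (ha : 1 ≤ a) :
    ∃ c : ℝ, 0 < c ∧ ∀ᶠ u : ℕ in atTop, ∀ (X : ℕ) (G₁ : Finset ℕ) (G₂ : Finset (Fin k → ℕ)),
      u ^ ((a + 1) * k + 2 * a + 3) ≤ X → X ≤ u ^ ((a + 1) * k + 2 * a + 4) →
      (∀ m ∈ G₁, 1 ≤ m ∧ m ≤ u ^ a) →
      (∀ f ∈ G₂, ∀ i, (f i).Prime ∧ u ^ a < f i ∧ f i ≤ u ^ (a + 1)) →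
      ∃ A : Finset ℕ, (∀ n ∈ A, ∃ m ∈ G₁, ∃ f ∈ G₂, ∃ P : ℕ, P.Prime ∧ P ≤ u ^ (k + 2 * a + 4) ∧
          n = p₀ * m * (∏ i, f i) * P ∧ 1 ≤ n ∧ n ≤ X) ∧
        c * X / Real.log u * (∑ m ∈ G₁, 1 / (m : ℝ)) * (∑ f ∈ G₂, ∏ i, 1 / (f i : ℝ)) ≤
          (A.card : ℝ) := by
  obtain ⟨c, hc, h⟩ := exists_card_prime_Ioc_ge (a + 1) (k + 2 * a + 4)
  have hp₀' : (0 : ℝ) < p₀ := by exact_mod_cast hp₀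
  have hkk : (0 : ℝ) < (k : ℝ) ^ k := by
    have := Nat.pow_self_pos (n := k)
    exact_mod_cast this
  refine ⟨c / (2 * p₀) / k ^ k, by positivity, ?_⟩
  filter_upwards [h, eventually_ge_atTop p₀, eventually_ge_atTop 2] with u hu hpu hu2
    X G₁ G₂ hX hX' hG₁ hG₂
  have hu0 : (2 : ℝ) ≤ u := by exact_mod_cast hu2
  have hl : 0 < Real.log u := Real.log_pos (by linarith)
  have huu : u ≤ u ^ a := Nat.le_self_pow (by omega) u
  have hle : u ^ a ≤ u ^ (a + 1) := Nat.pow_le_pow_right (by omega) (by omega)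
  set Q : ℕ × (Fin k → ℕ) → Finset ℕ := fun g =>
    (Finset.Ioc (u ^ (a + 1)) (X / (p₀ * g.1 * ∏ i, g.2 i))).filter Nat.Prime with hQ
  set S : Finset ((_ : ℕ × (Fin k → ℕ)) × ℕ) := (G₁ ×ˢ G₂).sigma Q with hS
  have hbd : ∀ g ∈ G₁ ×ˢ G₂, 0 < p₀ * g.1 * ∏ i, g.2 i ∧
      u ^ (a + 2) ≤ X / (p₀ * g.1 * ∏ i, g.2 i) ∧
      X / (p₀ * g.1 * ∏ i, g.2 i) ≤ u ^ (k + 2 * a + 4) := fun g hg => by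
    obtain ⟨h1, h2⟩ := Finset.mem_product.1 hg
    exact pow_le_div_le_pow hp₀ hpu (hG₁ _ h1).1 (hG₁ _ h1).2 (fun i => (hG₂ _ h2 i).2) hX hX'
  have hSmem : ∀ s ∈ S, s.1.1 ∈ G₁ ∧ s.1.2 ∈ G₂ ∧ s.2.Prime ∧ u ^ (a + 1) < s.2 ∧
      s.2 ≤ X / (p₀ * s.1.1 * ∏ i, s.1.2 i) := fun s hs => by
    obtain ⟨h1, h2⟩ := Finset.mem_sigma.1 hs
    obtain ⟨h3, h4⟩ := Finset.mem_filter.1 h2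
    obtain ⟨h5, h6⟩ := Finset.mem_Ioc.1 h3
    obtain ⟨h7, h8⟩ := Finset.mem_product.1 h1
    exact ⟨h7, h8, h4, h5, h6⟩
  refine ⟨S.image fun s => p₀ * s.1.1 * (∏ i, s.1.2 i) * s.2, fun n hn => ?_, ?_⟩
  · obtain ⟨s, hs, rfl⟩ := Finset.mem_image.1 hn
    obtain ⟨h1, h2, h3, h4, h5⟩ := hSmem s hs
    obtain ⟨h6, h7, h8⟩ := hbd s.1 (Finset.mem_product.2 ⟨h1, h2⟩)
    refine ⟨_, h1, _, h2, _, h3, h5.trans h8, rfl, Nat.mul_pos h6 h3.pos, ?_⟩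
    rw [Nat.le_div_iff_mul_le h6] at h5
    linarith
  · have hcard : (S.card : ℝ) ≤ k ^ k *
        ((S.image fun s => p₀ * s.1.1 * (∏ i, s.1.2 i) * s.2).card : ℝ) := by
      have := card_le_mul_card_image_mul_prod (S := S) (p₀ := p₀) (M := u ^ a) (W := u ^ a)
        (U := u ^ (a + 1)) (fun s hs => by
          obtain ⟨h1, h2, h3, h4, h5⟩ := hSmem s hs
          exact ⟨(hG₁ _ h1).1, (hG₁ _ h1).2, hG₂ _ h2, h3, h4⟩) hp₀ (hpu.trans huu) le_rfl hle
      exact_mod_cast this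
    have hlow : c / (2 * p₀) * X / Real.log u * (∑ m ∈ G₁, 1 / (m : ℝ)) *
        (∑ f ∈ G₂, ∏ i, 1 / (f i : ℝ)) ≤ S.card := by
      rw [hS, Finset.card_sigma, Nat.cast_sum, mul_assoc, Finset.sum_mul_sum, ← Finset.sum_product',
        Finset.mul_sum]
      refine Finset.sum_le_sum fun g hg => ?_
      obtain ⟨h1, h2, h3⟩ := hbd g hg
      have h4 := half_div_le_natDiv h1 ((Nat.one_le_pow _ _ (by omega)).trans h2)
      refine le_trans ?_ (hu _ h2 h3)
      calc c / (2 * p₀) * X / Real.log u * (1 / (g.1 : ℝ) * ∏ i, 1 / (g.2 i : ℝ))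
          = c * (X / (2 * (p₀ * g.1 * ∏ i, g.2 i : ℕ))) / Real.log u := by
            rw [Finset.prod_div_distrib, Finset.prod_const_one]
            push_cast
            simp only [div_eq_mul_inv, mul_inv, one_mul]
            ring
        _ ≤ _ := by gcongr
    refine le_of_mul_le_mul_left (le_trans (le_of_eq ?_) (hlow.trans hcard)) hkk
    field_simp

theorem pow_le_dexp_sub_pow {u e t h n : ℕ} (hu : 1 ≤ u) (het : e ≤ t)
    (hut : u ^ 2 ^ (e + 3) < dexp (t + 1)) (hn : n ≤ 4 * h) : u ^ n ≤ dexp (t - e) ^ h := by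
  have h1 : (u ^ 4) ^ 2 ^ (e + 1) < dexp (t - e) ^ 2 ^ (e + 1) := by
    rw [← dexp_add, show t - e + (e + 1) = t + 1 by omega, ← pow_mul]
    convert hut using 2
    ring
  calc u ^ n ≤ u ^ (4 * h) := Nat.pow_le_pow_right hu hn
    _ = (u ^ 4) ^ h := pow_mul _ _ _
    _ ≤ _ := Nat.pow_le_pow_left (lt_of_pow_lt_pow_left₀ _ (by omega) h1).le h

theorem GoodAt.mono {e J J' j n : ℕ} (h : GoodAt e J j n) (hJ : J' ≤ J) : GoodAt e J' j n := by
  obtain ⟨T, h1, h2⟩ := h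
  exact ⟨T, hJ.trans h1, h2⟩

theorem exists_card_uDense_carmichael_ge :
    ∃ c : ℝ, 0 < c ∧ ∀ᶠ X : ℕ in atTop,
      c * X ≤ (((Finset.Icc 1 X).filter (fun n => UDense (carmichael n) 2)).card : ℝ) := by
  obtain ⟨e, i₀, hei, hscale, hI⟩ := exists_hits_scale
  obtain ⟨j₀, K, hij, hm⟩ := exists_sum_forall_goodAt_ge hei hscale (2 ^ (e + 1))
  set a : ℕ := 2 ^ (e + 3) with ha
  have ha1 : 1 ≤ a := Nat.one_le_two_pow
  have he0 : 0 < 2 ^ e := by positivity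
  set h : ℕ := 2 ^ (e + 1) + a + 2 + K with hh
  have hK : ((K + 1 : ℕ) : ℝ) / 4 ^ h ≤ 1 / 4 := by
    rw [div_le_div_iff₀ (by positivity) (by norm_num)]
    have h1 : (K + 1) * 4 ≤ 1 * 4 ^ h := by
      calc (K + 1) * 4 ≤ 4 ^ K * 4 := Nat.mul_le_mul_right _ (Nat.lt_pow_self (by norm_num))
        _ = 1 * 4 ^ (K + 1) := by ring
        _ ≤ 1 * 4 ^ h := Nat.mul_le_mul_left _ (Nat.pow_le_pow_right (by norm_num) (by omega))
    exact_mod_cast h1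
  obtain ⟨t₀, ht₀⟩ := exists_sum_forall_goodAt_prod_ge e i₀ (K + 1) a ha1 (by omega) hK
  obtain ⟨p₀, hp₀, -, hp₀v⟩ := Nat.exists_prime_gt_modEq_one (k := dexp j₀) 0 (dexp_pos j₀).ne'
  have hv : dexp j₀ ∣ p₀ - 1 := (Nat.modEq_iff_dvd' hp₀.one_le).1 hp₀v.symm
  obtain ⟨c, hc, hcount⟩ := exists_card_image_ge p₀ a (2 * h) hp₀.one_le ha1
  set E : ℕ := (a + 1) * (2 * h) + 2 * a + 3 with hE
  refine ⟨c * (a / 4) * ((1 / (2 * (a + 1))) ^ (2 * h) / 2), by positivity, ?_⟩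
  have hev : ∀ᶠ u : ℕ in atTop, dexp (t₀ + e) ≤ u ∧ p₀ ≤ u := by
    filter_upwards [eventually_ge_atTop (dexp (t₀ + e)), eventually_ge_atTop p₀] with u h1 h2
      using ⟨h1, h2⟩
  filter_upwards [eventually_exists_pow_le_le (E := E) (by omega)
    (hev.and ((hI a ha1).and hcount))] with X hX
  obtain ⟨u, ⟨⟨hut, hpu⟩, ⟨hμ, hν⟩, hu⟩, hXl, hXu⟩ := hX
  have hu2 : 2 ≤ u := hp₀.two_le.trans hpu
  have huu : u ≤ u ^ a := Nat.le_self_pow (by omega) u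
  obtain ⟨t, htt, htu, hut'⟩ := exists_dexp_le_lt (hut.trans huu)
  obtain ⟨I, hIdef⟩ : ∃ I, I = (Finset.Ioc (u ^ a) (u ^ (a + 1))).filter Nat.Prime := ⟨_, rfl⟩
  rw [← hIdef] at hμ
  have hf := ht₀ t u (by omega) htu (hut'.trans_le (dexp_mono (by omega))) I hIdef hμ
    fun j hj hju => by
      have := hν j hj hju
      rw [← Finset.filter_filter, ← hIdef] at this
      convert this
  have hImem : ∀ p ∈ I, p.Prime ∧ u ^ a < p ∧ p ≤ u ^ (a + 1) := fun p hp => by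
    rw [hIdef] at hp
    obtain ⟨h1, h2⟩ := Finset.mem_filter.1 hp
    exact ⟨h2, Finset.mem_Ioc.1 h1⟩
  obtain ⟨G₁, hG₁⟩ : ∃ G : Finset ℕ, G = (Finset.Icc 1 (dexp t)).filter
    (fun m => ∀ j, j₀ ≤ j → j + K ≤ t → GoodAt e (2 ^ (e + 1)) j m) := ⟨_, rfl⟩
  obtain ⟨G₂, hG₂⟩ : ∃ G : Finset (Fin (2 * h) → ℕ), G =
    (Fintype.piFinset (fun _ : Fin (2 * h) => I)).filter
      (fun f => ∀ j, j ≤ t → t < j + (K + 1) → GoodAt e h j (∏ i, f i)) := ⟨_, rfl⟩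
  have hmt := hm t
  rw [← hG₁] at hmt
  rw [← hG₂] at hf
  have hmem₁ : ∀ m ∈ G₁, (1 ≤ m ∧ m ≤ u ^ a) ∧
      ∀ j, j₀ ≤ j → j + K ≤ t → GoodAt e (2 ^ (e + 1)) j m := fun m hm => by
    rw [hG₁] at hm
    obtain ⟨h1, h2⟩ := Finset.mem_filter.1 hm
    exact ⟨⟨(Finset.mem_Icc.1 h1).1, (Finset.mem_Icc.1 h1).2.trans htu⟩, h2⟩
  have hmem₂ : ∀ f ∈ G₂, (∀ i, (f i).Prime ∧ u ^ a < f i ∧ f i ≤ u ^ (a + 1)) ∧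
      ∀ j, j ≤ t → t < j + (K + 1) → GoodAt e h j (∏ i, f i) := fun f hf => by
    rw [hG₂] at hf
    obtain ⟨h1, h2⟩ := Finset.mem_filter.1 hf
    exact ⟨fun i => hImem _ (Fintype.mem_piFinset.1 h1 i), h2⟩
  obtain ⟨A, hA, hAcard⟩ := hu X G₁ G₂ hXl hXu (fun m hm => (hmem₁ m hm).1)
    (fun f hf => (hmem₂ f hf).1)
  have hAsub : A ⊆ (Finset.Icc 1 X).filter (fun n => UDense (carmichael n) 2) := by
    intro n hn
    obtain ⟨m, hm, f, hf, P, hP, hPu, hnmf, hn1, hnX⟩ := hA n hn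
    obtain ⟨⟨hm1, hmu⟩, hmg⟩ := hmem₁ m hm
    obtain ⟨hfI, hfg⟩ := hmem₂ f hf
    have hmn : m ∣ n := by
      rw [hnmf, mul_assoc, mul_assoc]
      exact (dvd_mul_right m _).mul_left p₀
    have hfn : ∏ i, f i ∣ n := by
      rw [hnmf]
      exact (dvd_mul_left _ _).mul_right P
    refine Finset.mem_filter.2 ⟨Finset.mem_Icc.2 ⟨hn1, hnX⟩, ?_⟩
    refine uDense_carmichael_of_goodAt (B := u ^ (2 * h + 2 * a + 4)) (p₀ := p₀) (e := e)
      (j₀ := j₀) (t := t) (h := h) (by omega) ?_ hp₀ ?_ hv (by omega) ?_ ?_ ?_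
    · intro p hp hpn
      rw [hnmf] at hpn
      have hpow : ∀ {b}, b ≤ 2 * h + 2 * a + 4 → u ^ b ≤ u ^ (2 * h + 2 * a + 4) :=
        fun hb => Nat.pow_le_pow_right (by omega) hb
      rcases hp.dvd_mul.1 hpn with hpn | hpn
      · rcases hp.dvd_mul.1 hpn with hpn | hpn
        · rcases hp.dvd_mul.1 hpn with hpn | hpn
          · exact ((Nat.le_of_dvd hp₀.pos hpn).trans (hpu.trans huu)).trans (hpow (by omega))
          · exact ((Nat.le_of_dvd hm1 hpn).trans hmu).trans (hpow (by omega))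
        · obtain ⟨l, -, hl⟩ := (Prime.dvd_finsetProd_iff hp.prime _).1 hpn
          exact ((Nat.le_of_dvd (hfI l).1.pos hl).trans (hfI l).2.2).trans (hpow (by omega))
      · exact (Nat.le_of_dvd hP.pos hpn).trans hPu
    · rw [hnmf, mul_assoc, mul_assoc]
      exact dvd_mul_right _ _
    · intro j hj hjt
      by_cases hjK : j + K ≤ t
      · exact (hmg j hj hjK).of_dvd hmn
      · exact ((hfg j hjt.le (by omega)).of_dvd hfn).mono (by omega)
    · exact (hfg t le_rfl (by omega)).of_dvd hfn
    · exact pow_le_dexp_sub_pow (by omega) (by omega) hut' (by omega)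
  have hu0 : (2 : ℝ) ≤ u := by exact_mod_cast hu2
  have hl : 0 < Real.log u := Real.log_pos (by linarith)
  have hlog : a / 4 * Real.log u ≤ Real.log (dexp t) / 2 := by
    have h1 : Real.log ((u : ℝ) ^ a) ≤ Real.log (dexp (t + 1)) :=
      Real.log_le_log (by positivity) (by exact_mod_cast hut'.le)
    rw [Real.log_pow, log_dexp, pow_succ] at h1
    rw [log_dexp]
    linarith
  calc c * (a / 4) * ((1 / (2 * (a + 1))) ^ (2 * h) / 2) * X
      = c * X / Real.log u * (a / 4 * Real.log u) * ((1 / (2 * (a + 1))) ^ (2 * h) / 2) := by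
        field_simp
    _ ≤ c * X / Real.log u * (∑ m ∈ G₁, 1 / (m : ℝ)) *
        (∑ f ∈ G₂, ∏ i, 1 / (f i : ℝ)) := by
        have h1 := hlog.trans hmt
        have h2 : ((1 : ℝ) / (2 * (a + 1))) ^ (2 * h) / 2 ≤ ∑ f ∈ G₂, ∏ i, 1 / (f i : ℝ) :=
          le_trans (by gcongr) hf
        gcongr
    _ ≤ A.card := hAcard
    _ ≤ _ := by exact_mod_cast Finset.card_le_card hAsub

theorem stmt_5 : ∃ c : ℝ, 0 < c ∧ ∀ᶠ x : ℝ in atTop,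
    c * x ≤ (((Finset.Icc 1 ⌊x⌋₊).filter (fun n => UDense (carmichael n) 2)).card : ℝ) := by
  obtain ⟨c, hc, h⟩ := exists_card_uDense_carmichael_ge
  refine ⟨c / 2, by positivity, ?_⟩
  filter_upwards [tendsto_nat_floor_atTop.eventually h, eventually_ge_atTop 1] with x hx hx1
  refine le_trans ?_ hx
  have h1 := Nat.lt_floor_add_one x
  have h2 : (1 : ℝ) ≤ ⌊x⌋₊ := by exact_mod_cast Nat.le_floor (by simpa using hx1)
  calc c / 2 * x ≤ c / 2 * (2 * ⌊x⌋₊) := by gcongr; linarith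
    _ = _ := by ring
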